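/- There is a polynomial q such that every theta-free graph G has average degree at most q(ω(G)). -/

import Mathlib

open SimpleGraph

namespace Paper

variable {V : Type*}

/-- `S` is an independent (stable) set in `G`. -/
def IsIndep (G : SimpleGraph V) (S : Set V) : Prop :=
  ∀ ⦃a⦄, a ∈ S → ∀ ⦃b⦄, b ∈ S → a ≠ b → ¬ G.Adj a b

/-- The independence number of `S` is at most `k`. -/
def IndepNumLE (G : SimpleGraph V) (S : Set V) (k : ℕ) : Prop :=
  ∀ T : Finset V, ↑T ⊆ S → IsIndep G ↑T → T.card ≤ k

/-- There are no edges between `A` and `B`. -/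
def Anticomplete (G : SimpleGraph V) (A B : Set V) : Prop :=
  ∀ ⦃a⦄, a ∈ A → ∀ ⦃b⦄, b ∈ B → ¬ G.Adj a b

/-- `G` has no induced `K_{t,t}`. -/
def KttFree (G : SimpleGraph V) (t : ℕ) : Prop :=
  ¬ ∃ A B : Finset V, Disjoint A B ∧ A.card = t ∧ B.card = t ∧
      IsIndep G ↑A ∧ IsIndep G ↑B ∧ ∀ a ∈ A, ∀ b ∈ B, G.Adj a b

/-- `P` is an induced path in `G`. -/
def IsInducedPathW (G : SimpleGraph V) {a b : V} (P : G.Walk a b) : Prop :=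
  P.IsPath ∧ ∀ u ∈ P.support, ∀ v ∈ P.support, G.Adj u v → s(u, v) ∈ P.edges

/-- The interior of a path: its support minus the two ends. -/
def interiorSet (G : SimpleGraph V) {a b : V} (P : G.Walk a b) : Set V :=
  {v | v ∈ P.support ∧ v ≠ a ∧ v ≠ b}

/-- `G` contains a theta as an induced subgraph. -/
def ContainsTheta (G : SimpleGraph V) : Prop :=
  ∃ (a b : V) (P₁ P₂ P₃ : G.Walk a b),
    a ≠ b ∧ ¬ G.Adj a b ∧
    IsInducedPathW G P₁ ∧ IsInducedPathW G P₂ ∧ IsInducedPathW G P₃ ∧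
    2 ≤ P₁.length ∧ 2 ≤ P₂.length ∧ 2 ≤ P₃.length ∧
    Disjoint (interiorSet G P₁) (interiorSet G P₂) ∧
    Disjoint (interiorSet G P₁) (interiorSet G P₃) ∧
    Disjoint (interiorSet G P₂) (interiorSet G P₃) ∧
    Anticomplete G (interiorSet G P₁) (interiorSet G P₂) ∧
    Anticomplete G (interiorSet G P₁) (interiorSet G P₃) ∧
    Anticomplete G (interiorSet G P₂) (interiorSet G P₃)

def ThetaFree (G : SimpleGraph V) : Prop := ¬ ContainsTheta G

/-- `G` contains a pyramid as an induced subgraph. -/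
def ContainsPyramid (G : SimpleGraph V) : Prop :=
  ∃ (a : V) (b : Fin 3 → V) (P : ∀ i : Fin 3, G.Walk a (b i)),
    Function.Injective b ∧
    (∀ i j : Fin 3, i ≠ j → G.Adj (b i) (b j)) ∧
    (∀ i, IsInducedPathW G (P i)) ∧
    (∀ i, 1 ≤ (P i).length) ∧
    (∀ i j : Fin 3, i ≠ j → (P i).length = 1 → (P j).length ≠ 1) ∧
    (∀ i j : Fin 3, i ≠ j → ∀ v, v ∈ (P i).support → v ∈ (P j).support → v = a) ∧
    (∀ i j : Fin 3, i ≠ j → ∀ u ∈ (P i).support, ∀ v ∈ (P j).support,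
      u ≠ a → v ≠ a → G.Adj u v → u = b i ∧ v = b j)

def PyramidFree (G : SimpleGraph V) : Prop := ¬ ContainsPyramid G

/-- Open neighborhood of a set. -/
def nbhdS (G : SimpleGraph V) (X : Set V) : Set V := {v | v ∉ X ∧ ∃ x ∈ X, G.Adj x v}

/-- Closed neighborhood of a set. -/
def nbhdC (G : SimpleGraph V) (X : Set V) : Set V := X ∪ nbhdS G X

/-- The boundary of `X` inside the induced subgraph `G[U]`. -/
def delta1 (G : SimpleGraph V) (U X : Set V) : Set V :=
  {v | v ∈ X ∧ ∃ u ∈ U \ X, G.Adj v u}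

def delta2 (G : SimpleGraph V) (U X : Set V) : Set V := delta1 G U (X \ delta1 G U X)

/-- `S` induces a connected subgraph. -/
def ConnSet (G : SimpleGraph V) (S : Set V) : Prop := (G.induce S).Connected

/-- `X` is a cooperative set in the induced subgraph `G[U]`. -/
def Cooperative (G : SimpleGraph V) (U X : Set V) : Prop :=
  X ⊆ U ∧ ConnSet G X ∧
  (∀ v ∈ delta1 G U X, ∃ u ∈ X \ delta1 G U X, G.Adj v u) ∧
  (∀ v ∈ delta2 G U X, ∃ u ∈ X \ (delta1 G U X ∪ delta2 G U X), G.Adj v u) ∧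
  ConnSet G (X \ (delta1 G U X ∪ delta2 G U X))

/-- The finite set `A` is matched into `B` by a matching of `G`. -/
def MatchedInto (G : SimpleGraph V) (A : Finset V) (B : Set V) : Prop :=
  ∃ f : V → V, Set.InjOn f ↑A ∧ ∀ a ∈ A, f a ∈ B ∧ G.Adj a (f a)

/-- There are `|A|` paths from `A` to `b`, pairwise vertex-disjoint except at `b`,
internally disjoint from `N[X]`. -/
def LinkedTo (G : SimpleGraph V) (X : Set V) (A : Finset V) (b : V) : Prop :=
  ∃ P : ∀ a ∈ A, G.Walk a b,
    (∀ a (ha : a ∈ A), (P a ha).IsPath) ∧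
    (∀ a (ha : a ∈ A), ∀ v ∈ (P a ha).support, v ≠ a → v ≠ b → v ∉ nbhdC G X) ∧
    (∀ a (ha : a ∈ A), ∀ a' (ha' : a' ∈ A), a ≠ a' →
      ∀ v, v ∈ (P a ha).support → v ∈ (P a' ha').support → v = b)

/-- `(S, I)` is a matroid. -/
def IsMatroid [DecidableEq V] (S : Set V) (I : Set (Finset V)) : Prop :=
  (∅ ∈ I) ∧ (∀ A ∈ I, ↑A ⊆ S) ∧
  (∀ A B : Finset V, A ⊆ B → B ∈ I → A ∈ I) ∧
  (∀ A B : Finset V, A ∈ I → B ∈ I → A.card < B.card → ∃ x ∈ B, x ∉ A ∧ insert x A ∈ I)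

/-- `D` is a connected component of `G` minus the set `avoid`. -/
def IsCompAvoiding (G : SimpleGraph V) (avoid D : Set V) : Prop :=
  D ⊆ avoidᶜ ∧ ConnSet G D ∧ ∀ u, u ∉ D → u ∉ avoid → ¬ ∃ d ∈ D, G.Adj u d

/-- `Z` is a constricted set. -/
def Constricted (G : SimpleGraph V) (Z : Set V) : Prop :=
  IsIndep G Z ∧ ∀ S : Set V, (G.induce S).IsTree → (Z ∩ S).ncard ≤ 2

end Paper

namespace ThetaProof

open Finset

open scoped Classical

variable {V : Type*}

/-- degree into a finite set -/
noncomputable def dg (G : SimpleGraph V) (S : Finset V) (v : V) : ℕ :=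
  (S.filter (fun u => G.Adj v u)).card

noncomputable def vol (G : SimpleGraph V) (S : Finset V) : ℕ := ∑ v ∈ S, dg G S v

def Degen (G : SimpleGraph V) (S : Finset V) (d : ℕ) : Prop :=
  ∀ T ⊆ S, T.Nonempty → ∃ v ∈ T, dg G T v ≤ d

def TriFree (G : SimpleGraph V) (S : Finset V) : Prop :=
  ∀ a ∈ S, ∀ b ∈ S, ∀ c ∈ S, G.Adj a b → G.Adj b c → G.Adj a c → False

/-- out-neighbours with respect to a rank function -/
noncomputable def out (G : SimpleGraph V) (S : Finset V) (r : V → ℕ) (v : V) : Finset V :=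
  S.filter (fun u => G.Adj v u ∧ r v < r u)

lemma dg_mono {G : SimpleGraph V} {S T : Finset V} (h : S ⊆ T) (v : V) : dg G S v ≤ dg G T v :=
  card_le_card (filter_subset_filter _ h)

lemma exists_rank (G : SimpleGraph V) (d : ℕ) : ∀ S : Finset V, Degen G S d →
    ∃ r : V → ℕ, Set.InjOn r S ∧ ∀ v ∈ S, (out G S r v).card ≤ d := by
  intro S
  induction S using Finset.strongInduction with
  | H S ih =>
    intro hS
    rcases S.eq_empty_or_nonempty with rfl | hne
    · exact ⟨fun _ => 0, by simp, by simp⟩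
    obtain ⟨v, hv, hvd⟩ := hS S Subset.rfl hne
    obtain ⟨r, hr, hro⟩ := ih (S.erase v) (erase_ssubset hv)
      (fun T hT hTn => hS T (hT.trans (erase_subset _ _)) hTn)
    refine ⟨fun u => if u = v then 0 else r u + 1, ?_, ?_⟩
    · intro a ha b hb hab
      by_cases h1 : a = v <;> by_cases h2 : b = v <;> simp [h1, h2] at hab
      · rw [h1, h2]
      · exact hr (by simpa [h1] using ha) (by simpa [h2] using hb) hab
    · intro u hu
      by_cases h1 : u = v
      · subst h1
        refine le_trans (card_le_card ?_) hvd
        intro z hz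
        simp only [out, mem_filter] at hz ⊢
        exact ⟨hz.1, hz.2.1⟩
      · refine le_trans (card_le_card ?_) (hro u (by simp [h1, hu]))
        intro z hz
        simp only [out, mem_filter, mem_erase] at hz ⊢
        obtain ⟨hz1, hz2, hz3⟩ := hz
        by_cases h2 : z = v
        · simp [h2] at hz3
        · simp [h1, h2] at hz3
          exact ⟨⟨h2, hz1⟩, hz2, hz3⟩

lemma vol_eq {G : SimpleGraph V} {S : Finset V} {r : V → ℕ} (hr : Set.InjOn r S) :
    vol G S = 2 * ∑ v ∈ S, (out G S r v).card := by
  have h1 : ∀ v ∈ S, dg G S v = (out G S r v).card +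
      (S.filter (fun u => G.Adj v u ∧ r u < r v)).card := by
    intro v hv
    unfold dg out
    rw [← card_union_of_disjoint]
    · congr 1
      ext u
      simp only [mem_filter, mem_union]
      constructor
      · rintro ⟨hu, ha⟩
        rcases lt_trichotomy (r v) (r u) with h | h | h
        · exact Or.inl ⟨hu, ha, h⟩
        · exact absurd (hr hv hu h) ha.ne
        · exact Or.inr ⟨hu, ha, h⟩
      · rintro (⟨hu, ha, _⟩ | ⟨hu, ha, _⟩) <;> exact ⟨hu, ha⟩
    · rw [Finset.disjoint_left]
      intro u h1 h2
      simp only [mem_filter] at h1 h2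
      omega
  unfold vol
  rw [sum_congr rfl h1, sum_add_distrib, two_mul]
  congr 1
  have := sum_card_bipartiteAbove_eq_sum_card_bipartiteBelow (s := S) (t := S)
    (fun v u => G.Adj v u ∧ r u < r v)
  simp only [bipartiteAbove, bipartiteBelow] at this
  rw [this]
  refine sum_congr rfl fun v _ => ?_
  unfold out
  congr 1
  ext u
  simp [G.adj_comm]

lemma vol_le {G : SimpleGraph V} {S : Finset V} {d : ℕ} (h : Degen G S d) :
    vol G S ≤ 2 * (d * S.card) := by
  obtain ⟨r, hr, ho⟩ := exists_rank G d S h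
  rw [vol_eq hr]
  have := sum_le_card_nsmul S _ d ho
  simp only [smul_eq_mul] at this
  nlinarith

lemma exists_dense {G : SimpleGraph V} {S : Finset V} {d : ℕ} (h : ¬ Degen G S d) :
    ∃ T ⊆ S, T.Nonempty ∧ ∃ d' > d, (∀ v ∈ T, d' ≤ dg G T v) ∧ Degen G T d' := by
  have hex : ∃ k, Degen G S k :=
    ⟨S.card, fun T hT ⟨v, hv⟩ => ⟨v, hv, (card_le_card (filter_subset _ _)).trans (card_le_card hT)⟩⟩
  have hk := Nat.find_spec hex
  set k := Nat.find hex with hkdef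
  have hdk : d < k := by
    by_contra hc
    apply h
    intro T hT hTn
    obtain ⟨v, hv, hvk⟩ := hk T hT hTn
    exact ⟨v, hv, by omega⟩
  have hn : ¬ Degen G S (k - 1) := Nat.find_min hex (by omega)
  unfold Degen at hn
  push Not at hn
  obtain ⟨T, hT, hTn, hTd⟩ := hn
  exact ⟨T, hT, hTn, k, hdk, fun v hv => by have := hTd v hv; omega,
    fun U hU hUn => hk U (hU.trans hT) hUn⟩

/-- Bernoulli sampling weights -/
lemma sampling (V : Type*) [Fintype V] (p : ℝ) (h0 : 0 ≤ p) (h1 : p ≤ 1) :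
    ∃ w : Finset V → ℝ, (∀ R, 0 ≤ w R) ∧
      ∀ T : Finset V, ∑ R, w R * (if T ⊆ R then 1 else 0) = p ^ T.card := by
  refine ⟨fun R => p ^ R.card * (1 - p) ^ (univ \ R).card, fun R => by
    have : 0 ≤ 1 - p := by linarith
    positivity, fun T => ?_⟩
  have := prod_add (fun _ : V => p) (fun i => if i ∈ T then 0 else 1 - p) univ
  rw [← powerset_univ]
  have hl : ∏ i : V, (p + if i ∈ T then 0 else 1 - p) = p ^ T.card := by
    have : ∀ i : V, (p + if i ∈ T then 0 else 1 - p) = if i ∈ T then p else 1 := by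
      intro i; split_ifs <;> ring
    simp_rw [this]
    rw [prod_ite_mem, univ_inter, prod_const]
  rw [← hl, this]
  refine sum_congr rfl fun R _ => ?_
  rw [prod_const, mul_assoc]
  congr 1
  by_cases hT : T ⊆ R
  · rw [if_pos hT, mul_one, ← prod_const]
    refine prod_congr rfl fun i hi => ?_
    rw [if_neg]
    intro h
    simp at hi
    exact hi (hT h)
  · rw [if_neg hT, mul_zero]
    obtain ⟨i, hi, hiR⟩ := not_subset.1 hT
    exact (prod_eq_zero (i := i) (by simp [hiR]) (by simp [hi])).symm

/-- Turan type bound -/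
lemma turan (G : SimpleGraph V) : ∀ (w : ℕ) (T : Finset V),
    (∀ K ⊆ T, G.IsClique K → K.card ≤ w) →
    T.card ^ 2 ≤ w * ∑ x ∈ T, (T.filter (fun y => ¬ G.Adj x y)).card := by
  intro w
  induction w with
  | zero =>
    intro T h
    rcases T.eq_empty_or_nonempty with rfl | ⟨v, hv⟩
    · simp
    · have := h {v} (by simpa using hv) (by simp)
      simp at this
  | succ w ih =>
    intro T h
    rcases T.eq_empty_or_nonempty with rfl | hne
    · simp
    obtain ⟨y, hy, hmax⟩ := exists_max_image T (fun v => dg G T v) hne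
    set N := T.filter (fun u => G.Adj y u) with hN
    have hNT : N ⊆ T := filter_subset _ _
    have hi := ih N (by
      intro K hK hKc
      have hyK : y ∉ K := fun hh => by
        have := hK hh
        simp [hN] at this
      have := h (insert y K) (by
        intro z hz
        rcases mem_insert.1 hz with rfl | hz
        · exact hy
        · exact hNT (hK hz)) (by
        rw [coe_insert]
        refine hKc.insert ?_
        intro b hb _
        exact (mem_filter.1 (hK hb)).2)
      rw [card_insert_of_notMem hyK] at this
      omega)
    have hdeg : ∀ x ∈ T, T.card ≤ (T.filter (fun z => ¬ G.Adj x z)).card + N.card := by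
      intro x hx
      have h1 := card_filter_add_card_filter_not (s := T) (fun z => G.Adj x z)
      have h2 := hmax x hx
      simp only [dg] at h2
      rw [← hN] at h2
      omega
    have hNc : N.card ≤ T.card := card_le_card hNT
    obtain ⟨a, ha⟩ := Nat.exists_eq_add_of_le hNc
    have hsplit := sum_sdiff hNT (f := fun x => (T.filter (fun z => ¬ G.Adj x z)).card)
    have hA : a * a ≤ ∑ x ∈ T \ N, (T.filter (fun z => ¬ G.Adj x z)).card := by
      have h1 : (T \ N).card = a := by rw [card_sdiff_of_subset hNT]; omega
      have := card_nsmul_le_sum (T \ N) (fun x => (T.filter (fun z => ¬ G.Adj x z)).card) a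
        (fun x hx => by have := hdeg x (sdiff_subset hx); omega)
      rw [h1] at this
      simpa using this
    have hB : ∑ x ∈ N, (N.filter (fun z => ¬ G.Adj x z)).card ≤
        ∑ x ∈ N, (T.filter (fun z => ¬ G.Adj x z)).card :=
      sum_le_sum fun x _ => card_le_card (filter_subset_filter _ hNT)
    rw [← hsplit, ha]
    set X := ∑ x ∈ T \ N, (T.filter (fun z => ¬ G.Adj x z)).card
    set Y := ∑ x ∈ N, (T.filter (fun z => ¬ G.Adj x z)).card
    set Z := ∑ x ∈ N, (N.filter (fun z => ¬ G.Adj x z)).card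
    set b := N.card
    -- (b + a)^2 ≤ (w+1) (X + Y), b^2 ≤ w Z, Z ≤ Y, a^2 ≤ X
    have hZ : b ^ 2 ≤ w * Y := hi.trans (Nat.mul_le_mul_left _ hB)
    rcases Nat.eq_zero_or_pos w with rfl | hw
    · have : b = 0 := by nlinarith
      rw [this]
      nlinarith
    · have key : (w : ℤ) * (b + a) ^ 2 ≤ w * ((w + 1) * (a * a)) + (w + 1) * b ^ 2 := by
        nlinarith [sq_nonneg ((w : ℤ) * a - b)]
      have key' : w * (b + a) ^ 2 ≤ w * ((w + 1) * (a * a)) + (w + 1) * b ^ 2 := by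
        exact_mod_cast key
      refine le_of_mul_le_mul_left (a := w) ?_ hw
      calc w * (b + a) ^ 2 ≤ w * ((w + 1) * (a * a)) + (w + 1) * b ^ 2 := key'
        _ ≤ w * ((w + 1) * X) + (w + 1) * (w * Y) := by gcongr
        _ = w * ((w + 1) * (X + Y)) := by ring


def Stab (G : SimpleGraph V) (W : Finset V) : Prop := ∀ a ∈ W, ∀ b ∈ W, ¬ G.Adj a b

lemma two_mul_sum_powerset (X : Finset V) :
    2 * ∑ T ∈ X.powerset, T.card = X.card * 2 ^ X.card := by
  have h : ∑ T ∈ X.powerset, T.card = ∑ T ∈ X.powerset, (X \ T).card := by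
    refine sum_nbij' (fun T => X \ T) (fun T => X \ T) ?_ ?_ ?_ ?_ ?_
    · intro T _; simp
    · intro T _; simp
    · intro T hT; simp only [mem_powerset] at hT; exact Finset.sdiff_sdiff_eq_self hT
    · intro T hT; simp only [mem_powerset] at hT; exact Finset.sdiff_sdiff_eq_self hT
    · intro T hT; simp only [mem_powerset] at hT; rw [Finset.sdiff_sdiff_eq_self hT]
  rw [two_mul]
  nth_rw 2 [h]
  rw [← sum_add_distrib]
  have : ∀ T ∈ X.powerset, T.card + (X \ T).card = X.card := by
    intro T hT
    rw [mem_powerset] at hT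
    rw [card_sdiff_of_subset hT]
    have := card_le_card hT
    omega
  rw [sum_congr rfl this, sum_const, card_powerset, smul_eq_mul, mul_comm]

lemma aks_num (K D x s : ℕ) (hD : K * (4 ^ K + 1) ≤ D) (hs : 2 * s = x * 2 ^ x) :
    K * (1 + 2 ^ x) ≤ D + s := by
  rcases le_or_gt x (2 * K) with h | h
  · have : 2 ^ x ≤ 4 ^ K := by
      calc 2 ^ x ≤ 2 ^ (2 * K) := Nat.pow_le_pow_right (by norm_num) h
        _ = 4 ^ K := by rw [pow_mul]; norm_num
    have := Nat.mul_le_mul_left K this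
    nlinarith
  · have h1 : (2 * K + 1) * 2 ^ x ≤ 2 * s := by rw [hs]; exact Nat.mul_le_mul_right _ h
    have h2 : K ≤ D := by nlinarith [Nat.zero_le (K * 4 ^ K)]
    nlinarith

lemma aks_local (G : SimpleGraph V) (B : Finset V) (D K : ℕ) (htf : TriFree G B)
    (hD : K * (4 ^ K + 1) ≤ D) (v : V) (hv : v ∈ B) :
    K * (B.powerset.filter (fun W => Stab G W)).card ≤
      ∑ W ∈ B.powerset.filter (fun W => Stab G W),
        (D * (if v ∈ W then 1 else 0) + (W.filter (fun u => G.Adj v u)).card) := by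
  set I := B.powerset.filter (fun W => Stab G W) with hI
  set N := B.filter (fun u => G.Adj v u) with hN
  set g : Finset V → Finset V := fun W => W \ insert v N with hg
  have hmaps : ∀ W ∈ I, g W ∈ I.image g := fun W hW => mem_image_of_mem _ hW
  rw [card_eq_sum_card_fiberwise hmaps, ← sum_fiberwise_of_maps_to hmaps, mul_sum]
  refine sum_le_sum fun H hH => ?_
  obtain ⟨W0, hW0, rfl⟩ := mem_image.1 hH
  set H := g W0 with hHdef
  have hHB : H ⊆ B := sdiff_subset.trans (mem_powerset.1 (mem_filter.1 hW0).1)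
  have hHst : ∀ a ∈ H, ∀ b ∈ H, ¬ G.Adj a b := fun a ha b hb =>
    (mem_filter.1 hW0).2 a (sdiff_subset ha) b (sdiff_subset hb)
  have hHv : v ∉ H := by simp [hHdef, hg]
  have hHN : ∀ u ∈ H, u ∉ N := by
    intro u hu hn
    simp only [hHdef, hg, mem_sdiff, mem_insert, not_or] at hu
    exact hu.2.2 hn
  have hHa : ∀ u ∈ H, ¬ G.Adj v u := fun u hu ha => hHN u hu (by simp [hN, hHB hu, ha])
  set X := N.filter (fun u => ∀ h ∈ H, ¬ G.Adj u h) with hX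
  have hXN : X ⊆ N := filter_subset _ _
  have hNB : N ⊆ B := filter_subset _ _
  have hvN : v ∉ N := by simp [hN]
  have hNst : ∀ a ∈ N, ∀ b ∈ N, ¬ G.Adj a b := fun a ha b hb hab =>
    htf v hv a (hNB ha) b (hNB hb) (mem_filter.1 ha).2 hab (mem_filter.1 hb).2
  have hfib : I.filter (fun W => g W = H) =
      insert (insert v H) (X.powerset.image (fun T => H ∪ T)) := by
    ext W
    simp only [mem_filter, mem_insert, mem_image, mem_powerset, hI]
    constructor
    · rintro ⟨⟨hWB, hWst⟩, hgW⟩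
      by_cases hvW : v ∈ W
      · left
        rw [← hgW]
        ext u
        simp only [hg, mem_insert, mem_sdiff, not_or]
        constructor
        · intro hu
          by_cases huv : u = v
          · exact Or.inl huv
          · refine Or.inr ⟨hu, huv, fun hn => hWst v hvW u hu (mem_filter.1 hn).2⟩
        · rintro (rfl | h)
          · exact hvW
          · exact h.1
      · right
        refine ⟨W ∩ N, ?_, ?_⟩
        · intro u hu
          rw [mem_inter] at hu
          refine mem_filter.2 ⟨hu.2, fun h hh => hWst u hu.1 h ?_⟩
          rw [← hgW] at hh
          exact sdiff_subset hh
        · rw [← hgW]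
          ext u
          simp only [hg, mem_union, mem_inter, mem_insert, mem_sdiff, not_or]
          constructor
          · rintro (h | h) <;> exact h.1
          · intro hu
            by_cases hn : u ∈ N
            · exact Or.inr ⟨hu, hn⟩
            · exact Or.inl ⟨hu, fun h => hvW (h ▸ hu), hn⟩
    · rintro (rfl | ⟨T, hT, rfl⟩)
      · refine ⟨⟨insert_subset hv hHB, ?_⟩, ?_⟩
        · intro a ha b hb
          rcases mem_insert.1 ha with rfl | ha <;> rcases mem_insert.1 hb with rfl | hb
          · exact G.loopless.irrefl _
          · exact hHa b hb
          · exact fun h => hHa a ha h.symm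
          · exact hHst a ha b hb
        · ext u
          simp only [hg, mem_insert, mem_sdiff, not_or]
          constructor
          · rintro ⟨h1 | h1, h2, h3⟩
            · exact absurd h1 h2
            · exact h1
          · intro hu
            exact ⟨Or.inr hu, fun h => hHv (h ▸ hu), hHN u hu⟩
      · refine ⟨⟨union_subset hHB (hT.trans (hXN.trans hNB)), ?_⟩, ?_⟩
        · intro a ha b hb
          rcases mem_union.1 ha with ha | ha <;> rcases mem_union.1 hb with hb | hb
          · exact hHst a ha b hb
          · exact fun h => (mem_filter.1 (hT hb)).2 a ha h.symm
          · exact (mem_filter.1 (hT ha)).2 b hb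
          · exact hNst a (hXN (hT ha)) b (hXN (hT hb))
        · ext u
          simp only [hg, mem_insert, mem_sdiff, mem_union, not_or]
          constructor
          · rintro ⟨h1 | h1, h2, h3⟩
            · exact h1
            · exact absurd (hXN (hT h1)) h3
          · intro hu
            exact ⟨Or.inl hu, fun h => hHv (h ▸ hu), hHN u hu⟩
  have hnot : insert v H ∉ X.powerset.image (fun T => H ∪ T) := by
    intro h
    obtain ⟨T, hT, hTe⟩ := mem_image.1 h
    have : v ∈ H ∪ T := by rw [hTe]; exact mem_insert_self _ _
    rcases mem_union.1 this with h | h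
    · exact hHv h
    · exact hvN (hXN (mem_powerset.1 hT h))
  have hdisj : ∀ T ⊆ X, ∀ u ∈ T, u ∉ H := fun T hT u hu hh => hHN u hh (hXN (hT hu))
  have hinj : Set.InjOn (fun T => H ∪ T) (X.powerset : Set (Finset V)) := by
    intro T hT T' hT' he
    simp only [coe_powerset, Set.mem_preimage, Set.mem_powerset_iff, coe_subset] at hT hT'
    ext u
    have : u ∈ H ∪ T ↔ u ∈ H ∪ T' := by
      have he' : H ∪ T = H ∪ T' := he
      rw [he']
    rw [mem_union, mem_union] at this
    constructor
    · intro hu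
      exact (this.1 (Or.inr hu)).resolve_left (hdisj T hT u hu)
    · intro hu
      exact (this.2 (Or.inr hu)).resolve_left (hdisj T' hT' u hu)
  rw [hfib, card_insert_of_notMem hnot, sum_insert hnot, card_image_of_injOn hinj,
    sum_image hinj, card_powerset]
  have hval : ∀ T ∈ X.powerset, T.card ≤ (D * (if v ∈ H ∪ T then 1 else 0) +
      ((H ∪ T).filter (fun u => G.Adj v u)).card) := by
    intro T hT
    refine le_trans (card_le_card ?_) (Nat.le_add_left _ _)
    intro u hu
    exact mem_filter.2 ⟨mem_union_right _ hu, (mem_filter.1 (hXN (mem_powerset.1 hT hu))).2⟩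
  have h2 := sum_le_sum hval
  have h3 := aks_num K D X.card _ hD (two_mul_sum_powerset X)
  rw [add_comm 1] at h3
  have h4 : D ≤ D * (if v ∈ insert v H then 1 else 0) := by simp
  omega

lemma aks (G : SimpleGraph V) (B : Finset V) (D K : ℕ) (htf : TriFree G B)
    (hdeg : ∀ v ∈ B, dg G B v ≤ D) (hD : K * (4 ^ K + 1) ≤ D) :
    ∃ W ⊆ B, Stab G W ∧ K * B.card ≤ 2 * D * W.card := by
  set I := B.powerset.filter (fun W => Stab G W) with hI
  have hne : I.Nonempty := ⟨∅, mem_filter.2 ⟨by simp, fun a ha => by simp at ha⟩⟩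
  have h1 := sum_le_sum (fun v hv => aks_local G B D K htf hD v hv)
  rw [sum_comm, ← hI] at h1
  simp only [sum_const, smul_eq_mul] at h1
  have h2 : ∀ W ∈ I, ∑ v ∈ B, (D * (if v ∈ W then 1 else 0) +
      (W.filter (fun u => G.Adj v u)).card) ≤ 2 * D * W.card := by
    intro W hW
    have hWB : W ⊆ B := mem_powerset.1 (mem_filter.1 hW).1
    rw [sum_add_distrib, ← mul_sum]
    have e1 : ∑ v ∈ B, (if v ∈ W then 1 else 0) = W.card := by
      rw [← card_filter, filter_mem_eq_inter, inter_eq_right.2 hWB]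
    have e2 := sum_card_bipartiteAbove_eq_sum_card_bipartiteBelow (s := B) (t := W)
      (fun v u => G.Adj v u)
    simp only [bipartiteAbove, bipartiteBelow] at e2
    rw [e1, e2]
    have e3 : ∑ b ∈ W, (B.filter (fun a => G.Adj a b)).card ≤ W.card * D := by
      rw [← smul_eq_mul]
      refine sum_le_card_nsmul _ _ _ fun b hb => ?_
      have := hdeg b (hWB hb)
      unfold dg at this
      simpa only [G.adj_comm] using this
    nlinarith
  by_contra hcon
  push Not at hcon
  have h3 : ∑ W ∈ I, ∑ v ∈ B, (D * (if v ∈ W then 1 else 0) +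
      (W.filter (fun u => G.Adj v u)).card) < ∑ W ∈ I, K * B.card :=
    sum_lt_sum_of_nonempty hne fun W hW => lt_of_le_of_lt (h2 W hW)
      (hcon W (mem_powerset.1 (mem_filter.1 hW).1) (mem_filter.1 hW).2)
  simp only [sum_const, smul_eq_mul] at h3
  nlinarith


open Paper in
lemma theta23 (G : SimpleGraph V) {x y b₁ b₂ b₃ : V} (hxy : x ≠ y) (hna : ¬ G.Adj x y)
    (x1 : G.Adj x b₁) (x2 : G.Adj x b₂) (x3 : G.Adj x b₃)
    (y1 : G.Adj b₁ y) (y2 : G.Adj b₂ y) (y3 : G.Adj b₃ y)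
    (d12 : b₁ ≠ b₂) (d13 : b₁ ≠ b₃) (d23 : b₂ ≠ b₃)
    (n12 : ¬ G.Adj b₁ b₂) (n13 : ¬ G.Adj b₁ b₃) (n23 : ¬ G.Adj b₂ b₃) : ContainsTheta G := by
  have hind : ∀ b (h1 : G.Adj x b) (h2 : G.Adj b y),
      IsInducedPathW G (Walk.cons h1 (Walk.cons h2 Walk.nil)) := by
    intro b h1 h2
    refine ⟨by simp [Walk.isPath_def, h1.ne, h2.ne, hxy], ?_⟩
    intro u hu v hv huv
    simp only [Walk.support_cons, Walk.support_nil, List.mem_cons, List.not_mem_nil,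
      or_false] at hu hv
    simp only [Walk.edges_cons, Walk.edges_nil, List.mem_cons, List.not_mem_nil, or_false]
    have hna' : ¬ G.Adj y x := fun h => hna h.symm
    rcases hu with rfl | rfl | rfl <;> rcases hv with rfl | rfl | rfl <;>
      simp_all [Sym2.eq_swap]
  have hint : ∀ b (h1 : G.Adj x b) (h2 : G.Adj b y) (v : V),
      v ∈ interiorSet G (Walk.cons h1 (Walk.cons h2 Walk.nil)) → v = b := by
    intro b h1 h2 v hv
    simp only [interiorSet, Walk.support_cons, Walk.support_nil, List.mem_cons,
      List.not_mem_nil, or_false, Set.mem_ofPred_eq] at hv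
    tauto
  refine ⟨x, y, .cons x1 (.cons y1 .nil), .cons x2 (.cons y2 .nil), .cons x3 (.cons y3 .nil),
    hxy, hna, hind _ _ _, hind _ _ _, hind _ _ _, by simp, by simp, by simp,
    ?_, ?_, ?_, ?_, ?_, ?_⟩
  · rw [Set.disjoint_left]
    intro v h1 h2
    exact d12 ((hint _ _ _ _ h1).symm.trans (hint _ _ _ _ h2))
  · rw [Set.disjoint_left]
    intro v h1 h2
    exact d13 ((hint _ _ _ _ h1).symm.trans (hint _ _ _ _ h2))
  · rw [Set.disjoint_left]
    intro v h1 h2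
    exact d23 ((hint _ _ _ _ h1).symm.trans (hint _ _ _ _ h2))
  · intro u hu v hv
    rw [hint _ _ _ _ hu, hint _ _ _ _ hv]; exact n12
  · intro u hu v hv
    rw [hint _ _ _ _ hu, hint _ _ _ _ hv]; exact n13
  · intro u hu v hv
    rw [hint _ _ _ _ hu, hint _ _ _ _ hv]; exact n23

structure Subdiv (G H : SimpleGraph V) (m : Sym2 V → V) (A W : Finset V) : Prop where
  adj : ∀ u v, H.Adj u v → G.Adj u (m s(u, v))
  memA : ∀ u v, H.Adj u v → u ∈ A
  memW : ∀ u v, H.Adj u v → m s(u, v) ∈ W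
  ex : ∀ u v, H.Adj u v → ∀ z ∈ A, G.Adj z (m s(u, v)) → z = u ∨ z = v
  disj : Disjoint A W
  stA : Stab G A
  stW : Stab G W

section liftSec

variable {G H : SimpleGraph V} {m : Sym2 V → V} {A W : Finset V}

lemma Subdiv.inj (h : Subdiv G H m A W) {u v u' v' : V} (h1 : H.Adj u v) (h2 : H.Adj u' v')
    (he : m s(u, v) = m s(u', v')) : s(u, v) = s(u', v') := by
  have a1 := h.ex u' v' h2 u (h.memA _ _ h1) (he ▸ h.adj u v h1)
  have a2 := h.ex u' v' h2 v (h.memA _ _ h1.symm)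
    (by rw [← he, Sym2.eq_swap]; exact h.adj v u h1.symm)
  have := h1.ne
  rw [Sym2.eq_iff]
  rcases a1 with rfl | rfl <;> rcases a2 with rfl | rfl <;> simp_all

def lift (h : Subdiv G H m A W) : ∀ {u v : V}, H.Walk u v → G.Walk u v
  | _, _, .nil => .nil
  | u, _, .cons (v := w) ha p =>
    .cons (h.adj u w ha) (.cons
      (by have := h.adj w u ha.symm; rw [Sym2.eq_swap] at this; exact this.symm) (lift h p))

lemma mem_lift (h : Subdiv G H m A W) {u v : V} (p : H.Walk u v) (z : V) :
    z ∈ (lift h p).support ↔ z ∈ p.support ∨ ∃ e ∈ p.edges, z = m e := by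
  induction p with
  | nil => simp [lift]
  | cons ha p ih =>
    simp only [lift, Walk.support_cons, List.mem_cons, ih, Walk.edges_cons, exists_eq_or_imp]
    tauto

lemma lift_edges (h : Subdiv G H m A W) {u v : V} (p : H.Walk u v) (a b : V)
    (he : s(a, b) ∈ p.edges) : s(a, m s(a, b)) ∈ (lift h p).edges := by
  induction p with
  | nil => simp at he
  | @cons x y w ha p ih =>
    simp only [Walk.edges_cons, List.mem_cons] at he
    simp only [lift, Walk.edges_cons, List.mem_cons]
    rcases he with he | he
    · rw [he]
      rcases Sym2.eq_iff.1 he with ⟨rfl, rfl⟩ | ⟨rfl, rfl⟩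
      · exact Or.inl rfl
      · exact Or.inr (Or.inl Sym2.eq_swap)
    · exact Or.inr (Or.inr (ih he))

lemma support_subset_A (h : Subdiv G H m A W) {u v : V} (p : H.Walk u v) (hu : u ∈ A) :
    ∀ z ∈ p.support, z ∈ A := by
  induction p with
  | nil => simpa using hu
  | cons ha p ih =>
    intro z hz
    rcases List.mem_cons.1 (by simpa using hz) with rfl | hz
    · exact hu
    · exact ih (h.memA _ _ ha.symm) z hz

lemma mid_mem (h : Subdiv G H m A W) {u v : V} (p : H.Walk u v) {e : Sym2 V} (he : e ∈ p.edges) :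
    m e ∈ W := by
  induction e with
  | _ a b => exact h.memW a b (p.adj_of_mem_edges he)

lemma not_mem_both (h : Subdiv G H m A W) {z : V} (h1 : z ∈ A) (h2 : z ∈ W) : False :=
  Finset.disjoint_left.1 h.disj h1 h2

lemma lift_isPath (h : Subdiv G H m A W) {u v : V} (p : H.Walk u v) (hu : u ∈ A) (hp : p.IsPath) :
    (lift h p).IsPath := by
  induction p with
  | nil => simp [lift]
  | @cons x y w ha p ih =>
    rw [Walk.cons_isPath_iff] at hp
    have hy : y ∈ A := h.memA _ _ ha.symm
    simp only [lift, Walk.cons_isPath_iff, Walk.support_cons, List.mem_cons, mem_lift, not_or]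
    refine ⟨⟨ih hy hp.1, ?_, ?_⟩, ?_, hp.2, ?_⟩
    · intro hm
      exact not_mem_both h (support_subset_A h p hy _ hm) (h.memW _ _ ha)
    · rintro ⟨e, he, hee⟩
      induction e with
      | _ a b =>
        have := h.inj ha (p.adj_of_mem_edges he) hee
        rw [← this] at he
        exact hp.2 (p.fst_mem_support_of_mem_edges he)
    · intro hm
      exact not_mem_both h hu (hm ▸ h.memW _ _ ha)
    · rintro ⟨e, he, hee⟩
      exact not_mem_both h hu (hee ▸ mid_mem h p he)

lemma adj_mid (h : Subdiv G H m A W) {u v : V} (p : H.Walk u v) {e : Sym2 V} (he : e ∈ p.edges)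
    {z : V} (hz : z ∈ A) (ha : G.Adj z (m e)) : z ∈ e := by
  induction e with
  | _ a b =>
    rcases h.ex a b (p.adj_of_mem_edges he) z hz ha with rfl | rfl <;> simp

lemma edge_end {u v : V} (p : H.Walk u v) {e : Sym2 V} (he : e ∈ p.edges) {z : V} (hz : z ∈ e) :
    z ∈ p.support := Walk.mem_support_of_mem_edges he hz

lemma lift_induced (h : Subdiv G H m A W) {u v : V} (p : H.Walk u v) (hu : u ∈ A) (hp : p.IsPath) :
    Paper.IsInducedPathW G (lift h p) := by
  refine ⟨lift_isPath h p hu hp, ?_⟩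
  have key : ∀ a ∈ A, ∀ e ∈ p.edges, G.Adj a (m e) → s(a, m e) ∈ (lift h p).edges := by
    intro a ha e he hadj
    obtain ⟨b, rfl⟩ := adj_mid h p he ha hadj
    exact lift_edges h p a b he
  intro a ha b hb hab
  rw [mem_lift] at ha hb
  rcases ha with ha | ⟨e, he, rfl⟩ <;> rcases hb with hb | ⟨f, hf, rfl⟩
  · exact absurd hab (h.stA _ (support_subset_A h p hu _ ha) _ (support_subset_A h p hu _ hb))
  · exact key a (support_subset_A h p hu _ ha) f hf hab
  · rw [Sym2.eq_swap]
    exact key b (support_subset_A h p hu _ hb) e he hab.symm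
  · exact absurd hab (h.stW _ (mid_mem h p he) _ (mid_mem h p hf))

lemma lift_two (h : Subdiv G H m A W) {u v : V} (p : H.Walk u v) (huv : u ≠ v) :
    2 ≤ (lift h p).length := by
  cases p with
  | nil => exact absurd rfl huv
  | cons ha p => simp [lift]

lemma lift_sep (h : Subdiv G H m A W) {u v : V} (p q : H.Walk u v) (hu : u ∈ A)
    (hs : ∀ z, z ∈ p.support → z ∈ q.support → z = u ∨ z = v)
    (he : ∀ e, e ∈ p.edges → e ∈ q.edges → False) :
    Disjoint (Paper.interiorSet G (lift h p)) (Paper.interiorSet G (lift h q)) ∧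
    Paper.Anticomplete G (Paper.interiorSet G (lift h p)) (Paper.interiorSet G (lift h q)) := by
  have hpA := support_subset_A h p hu
  have hqA := support_subset_A h q hu
  constructor
  · rw [Set.disjoint_left]
    rintro z ⟨hz1, hzu, hzv⟩ ⟨hz2, -, -⟩
    rw [mem_lift] at hz1 hz2
    rcases hz1 with h1 | ⟨e, h1, rfl⟩ <;> rcases hz2 with h2 | ⟨f, h2, h3⟩
    · rcases hs z h1 h2 with h | h
      · exact hzu h
      · exact hzv h
    · exact not_mem_both h (hpA z h1) (h3 ▸ mid_mem h q h2)
    · exact not_mem_both h (hqA _ h2) (mid_mem h p h1)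
    · induction e with
      | _ a b =>
        induction f with
        | _ c d =>
          have := h.inj (p.adj_of_mem_edges h1) (q.adj_of_mem_edges h2) h3
          exact he _ h1 (this ▸ h2)
  · rintro a ⟨ha, hau, hav⟩ b ⟨hb, hbu, hbv⟩ hab
    rw [mem_lift] at ha hb
    rcases ha with h1 | ⟨e, h1, rfl⟩ <;> rcases hb with h2 | ⟨f, h2, rfl⟩
    · exact h.stA _ (hpA a h1) _ (hqA b h2) hab
    · have := edge_end q h2 (adj_mid h q h2 (hpA a h1) hab)
      rcases hs a h1 this with h | h
      · exact hau h
      · exact hav h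
    · have := edge_end p h1 (adj_mid h p h1 (hqA b h2) hab.symm)
      rcases hs b this h2 with h | h
      · exact hbu h
      · exact hbv h
    · exact h.stW _ (mid_mem h p h1) _ (mid_mem h q h2) hab

lemma theta_of_paths (h : Subdiv G H m A W) {u v : V} (huv : u ≠ v) (hu : u ∈ A) (hv : v ∈ A)
    (p q s : H.Walk u v) (hp : p.IsPath) (hq : q.IsPath) (hs : s.IsPath)
    (h1 : ∀ z, z ∈ p.support → z ∈ q.support → z = u ∨ z = v)
    (h2 : ∀ z, z ∈ p.support → z ∈ s.support → z = u ∨ z = v)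
    (h3 : ∀ z, z ∈ q.support → z ∈ s.support → z = u ∨ z = v)
    (e1 : ∀ e, e ∈ p.edges → e ∈ q.edges → False)
    (e2 : ∀ e, e ∈ p.edges → e ∈ s.edges → False)
    (e3 : ∀ e, e ∈ q.edges → e ∈ s.edges → False) : Paper.ContainsTheta G := by
  obtain ⟨d1, a1⟩ := lift_sep h p q hu h1 e1
  obtain ⟨d2, a2⟩ := lift_sep h p s hu h2 e2
  obtain ⟨d3, a3⟩ := lift_sep h q s hu h3 e3
  exact ⟨u, v, lift h p, lift h q, lift h s, huv, h.stA _ hu _ hv, lift_induced h p hu hp,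
    lift_induced h q hu hq, lift_induced h s hu hs, lift_two h p huv, lift_two h q huv,
    lift_two h s huv, d1, d2, d3, a1, a2, a3⟩

end liftSec


lemma append_disj {H : SimpleGraph V} {x a b : V} (r : H.Walk x a) (s : H.Walk a b)
    (hp : (r.append s).IsPath) {z : V} (h1 : z ∈ r.support) (h2 : z ∈ s.support) : z = a := by
  rw [Walk.isPath_def, Walk.support_append] at hp
  by_contra hz
  have h3 : z ∈ s.support.tail := by
    cases s with
    | nil => simp at h2; exact absurd h2 hz
    | cons h p =>
      simp only [Walk.support_cons, List.mem_cons] at h2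
      simpa using h2.resolve_left hz
  exact (List.nodup_append.1 hp).2.2 z h1 z h3 rfl

lemma theta_case {G H : SimpleGraph V} {m : Sym2 V → V} {A W : Finset V}
    (h : Subdiv G H m A W) {x x₁ a b : V} (hx : H.Adj x x₁)
    (T : H.Walk x₁ a) (S : H.Walk a b) (hp : (Walk.cons hx (T.append S)).IsPath)
    (hxa : H.Adj x a) (hxb : H.Adj x b) (ha1 : a ≠ x₁) (hab : a ≠ b) :
    Paper.ContainsTheta G := by
  have hp' : ((Walk.cons hx T).append S).IsPath := by simpa using hp
  have hr : (Walk.cons hx T).IsPath := hp'.of_append_left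
  have hs : S.IsPath := hp'.of_append_right
  have hdis : ∀ z, z ∈ (Walk.cons hx T).support → z ∈ S.support → z = a := fun z h1 h2 =>
    append_disj _ _ hp' h1 h2
  have hxS : x ∉ S.support := fun hh => hxa.ne (hdis x (by simp) hh)
  have hre : s(x, a) ∉ (Walk.cons hx T).edges := by
    intro he
    rw [Walk.edges_cons, List.mem_cons] at he
    rcases he with he | he
    · rw [Sym2.eq_iff] at he
      rcases he with ⟨_, h2⟩ | ⟨h1, h2⟩
      · exact ha1 h2
      · exact hxa.ne h2.symm
    · exact ((Walk.cons_isPath_iff _ _).1 hr).2 (T.fst_mem_support_of_mem_edges he)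
  have hpt : (Walk.cons hxb S.reverse).IsPath := by
    rw [Walk.cons_isPath_iff]
    exact ⟨hs.reverse, by simpa using hxS⟩
  have hte : s(x, a) ∉ (Walk.cons hxb S.reverse).edges := by
    intro he
    rw [Walk.edges_cons, List.mem_cons] at he
    rcases he with he | he
    · rw [Sym2.eq_iff] at he
      rcases he with ⟨_, h2⟩ | ⟨h1, h2⟩
      · exact hab h2
      · exact hxa.ne h2.symm
    · have := S.reverse.fst_mem_support_of_mem_edges he
      exact hxS (by simpa using this)
  have hqt : ∀ z, z ∈ (Walk.cons hx T).support → z ∈ (Walk.cons hxb S.reverse).support →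
      z = x ∨ z = a := by
    intro z h1 h2
    rw [Walk.support_cons, List.mem_cons] at h2
    rcases h2 with h2 | h2
    · exact Or.inl h2
    · exact Or.inr (hdis z h1 (by simpa using h2))
  refine theta_of_paths h hxa.ne (h.memA _ _ hxa) (h.memA _ _ hxa.symm)
    (Walk.cons hxa Walk.nil) (Walk.cons hx T) (Walk.cons hxb S.reverse) (by simp [hxa.ne]) hr hpt
    (fun z h1 _ => by simpa using h1) (fun z h1 _ => by simpa using h1) hqt ?_ ?_ ?_
  · intro e h1 h2
    simp only [Walk.edges_cons, Walk.edges_nil, List.mem_singleton] at h1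
    exact hre (h1 ▸ h2)
  · intro e h1 h2
    simp only [Walk.edges_cons (h := hxa), Walk.edges_nil, List.mem_singleton] at h1
    exact hte (h1 ▸ h2)
  · intro e h1 h2
    induction e with
    | _ c d =>
      have hcd := (Walk.cons hx T).adj_of_mem_edges h1
      have hc := hqt c (Walk.fst_mem_support_of_mem_edges _ h1)
        (Walk.fst_mem_support_of_mem_edges _ h2)
      have hd := hqt d (Walk.snd_mem_support_of_mem_edges _ h1)
        (Walk.snd_mem_support_of_mem_edges _ h2)
      rcases hc with rfl | rfl <;> rcases hd with rfl | rfl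
      · exact hcd.ne rfl
      · exact hre h1
      · exact hre (Sym2.eq_swap ▸ h1)
      · exact hcd.ne rfl

lemma theta_of_min_deg [Fintype V] {G H : SimpleGraph V} {m : Sym2 V → V} {A W : Finset V}
    (h : Subdiv G H m A W) (T : Finset V) (hT : T.Nonempty) (hd : ∀ v ∈ T, 3 ≤ dg H T v) :
    Paper.ContainsTheta G := by
  set P : ℕ → Prop := fun n => ∃ (x y : V) (p : H.Walk x y), p.IsPath ∧
    (∀ z ∈ p.support, z ∈ T) ∧ p.length = n with hP
  obtain ⟨v0, hv0⟩ := hT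
  have h0 : P 0 := ⟨v0, v0, .nil, by simp, by simpa using hv0, rfl⟩
  obtain ⟨x, y, p, hp, hpT, hlen⟩ : P (Nat.findGreatest P (Fintype.card V)) :=
    Nat.findGreatest_spec (Nat.zero_le _) h0
  have hmax : ∀ z ∈ T, H.Adj x z → z ∈ p.support := by
    intro z hz hxz
    by_contra hzp
    have hpath : (Walk.cons hxz.symm p).IsPath := (Walk.cons_isPath_iff _ _).2 ⟨hp, hzp⟩
    have hP' : P (p.length + 1) := ⟨z, y, .cons hxz.symm p, hpath, by
      intro w hw
      rw [Walk.support_cons, List.mem_cons] at hw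
      rcases hw with rfl | hw
      · exact hz
      · exact hpT w hw, by simp⟩
    have hl := hpath.length_lt
    rw [Walk.length_cons] at hl
    have := Nat.le_findGreatest hl.le hP'
    omega
  have hxT : x ∈ T := hpT x (by simp)
  have hdx := hd x hxT
  unfold dg at hdx
  cases p with
  | nil =>
    have : (T.filter (fun u => H.Adj x u)).Nonempty := card_pos.1 (by omega)
    obtain ⟨z, hz⟩ := this
    rw [mem_filter] at hz
    have := hmax z hz.1 hz.2
    simp at this
    exact absurd this hz.2.ne'
  | @cons _ x₁ _ hx p =>
    have hc : 1 < ((T.filter (fun u => H.Adj x u)).erase x₁).card := by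
      have := pred_card_le_card_erase (s := T.filter (fun u => H.Adj x u)) (a := x₁)
      omega
    obtain ⟨a, ha, b, hb, hab⟩ := one_lt_card.1 hc
    simp only [mem_erase, mem_filter] at ha hb
    have mem : ∀ z ∈ T, H.Adj x z → z ∈ p.support := by
      intro z hz hxz
      have := hmax z hz hxz
      rw [Walk.support_cons, List.mem_cons] at this
      exact this.resolve_left hxz.ne'
    have hap := mem a ha.2.1 ha.2.2
    have hbp := mem b hb.2.1 hb.2.2
    have spec := p.take_spec hap
    have hb' := hbp
    rw [← spec, Walk.mem_support_append_iff] at hb'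
    rcases hb' with hb' | hb'
    · have spec2 := (p.takeUntil a hap).take_spec hb'
      refine theta_case h hx ((p.takeUntil a hap).takeUntil b hb')
        ((p.takeUntil a hap).dropUntil b hb') ?_ hb.2.2 ha.2.2 hb.1 hab.symm
      rw [spec2]
      rw [← spec, ← Walk.cons_append] at hp
      exact hp.of_append_left
    · have spec2 := (p.dropUntil a hap).take_spec hb'
      refine theta_case h hx (p.takeUntil a hap)
        ((p.dropUntil a hap).takeUntil b hb') ?_ ha.2.2 hb.2.2 ha.1 hab
      rw [← spec, ← spec2, Walk.append_assoc, ← Walk.cons_append] at hp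
      exact hp.of_append_left

lemma theta_of_struct [Fintype V] (G : SimpleGraph V) (A W : Finset V) (hdisj : Disjoint A W)
    (hA : Stab G A) (hW : Stab G W)
    (htwo : ∀ b ∈ W, (A.filter (fun u => G.Adj b u)).card = 2)
    (hc : 4 * A.card < W.card) : Paper.ContainsTheta G := by
  by_contra hth
  let H : SimpleGraph V :=
    { Adj := fun x y => x ≠ y ∧ x ∈ A ∧ y ∈ A ∧ ∃ b ∈ W, G.Adj b x ∧ G.Adj b y
      symm := ⟨fun x y ⟨h1, h2, h3, b, hb, h4, h5⟩ => ⟨h1.symm, h3, h2, b, hb, h5, h4⟩⟩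
      loopless := ⟨fun x h => h.1 rfl⟩ }
  have hWne : W.Nonempty := card_pos.1 (by omega)
  obtain ⟨b0, hb0⟩ := hWne
  let m : Sym2 V → V := fun e => if h : ∃ b ∈ W, ∀ z ∈ e, G.Adj b z then h.choose else b0
  have hm : ∀ u v, H.Adj u v → m s(u, v) ∈ W ∧ ∀ z ∈ s(u, v), G.Adj (m s(u, v)) z := by
    intro u v ⟨h1, h2, h3, b, hb, h4, h5⟩
    have hex : ∃ b ∈ W, ∀ z ∈ s(u, v), G.Adj b z := ⟨b, hb, by
      intro z hz
      rcases Sym2.mem_iff.1 hz with rfl | rfl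
      · exact h4
      · exact h5⟩
    have : m s(u, v) = hex.choose := dif_pos hex
    rw [this]
    exact hex.choose_spec
  have hsub : Subdiv G H m A W :=
    { adj := fun u v h => ((hm u v h).2 u (by simp)).symm
      memA := fun u v h => h.2.1
      memW := fun u v h => (hm u v h).1
      disj := hdisj
      stA := hA
      stW := hW
      ex := by
        intro u v h z hz ha
        obtain ⟨h1, h2⟩ := hm u v h
        obtain ⟨p, q, hpq, he⟩ := card_eq_two.1 (htwo _ h1)
        have mu : u ∈ ({p, q} : Finset V) := he ▸ mem_filter.2 ⟨h.2.1, h2 u (by simp)⟩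
        have mv : v ∈ ({p, q} : Finset V) := he ▸ mem_filter.2 ⟨h.2.2.1, h2 v (by simp)⟩
        have mz : z ∈ ({p, q} : Finset V) := he ▸ mem_filter.2 ⟨hz, ha.symm⟩
        have := h.1
        simp only [mem_insert, mem_singleton] at mu mv mz
        rcases mu with rfl | rfl <;> rcases mv with rfl | rfl <;> tauto }
  have hcount := sum_card_bipartiteAbove_eq_sum_card_bipartiteBelow (s := W) (t := A.offDiag)
    (fun b xy => G.Adj b xy.1 ∧ G.Adj b xy.2)
  simp only [bipartiteAbove, bipartiteBelow] at hcount
  have hl : ∀ b ∈ W, (A.offDiag.filter (fun xy => G.Adj b xy.1 ∧ G.Adj b xy.2)).card = 2 := by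
    intro b hb
    have : A.offDiag.filter (fun xy => G.Adj b xy.1 ∧ G.Adj b xy.2) =
        (A.filter (fun u => G.Adj b u)).offDiag := by
      ext ⟨x, y⟩
      simp only [mem_filter, mem_offDiag]
      tauto
    rw [this, offDiag_card, htwo b hb]
  rw [sum_congr rfl hl, sum_const, smul_eq_mul] at hcount
  have hr : ∀ xy ∈ A.offDiag, (W.filter (fun b => G.Adj b xy.1 ∧ G.Adj b xy.2)).card ≤
      2 * (if H.Adj xy.1 xy.2 then 1 else 0) := by
    rintro ⟨x, y⟩ hxy
    rw [mem_offDiag] at hxy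
    dsimp only at hxy ⊢
    by_cases hH : H.Adj x y
    · rw [if_pos hH]
      by_contra hgt
      push Not at hgt
      obtain ⟨b₁, b₂, b₃, m1, m2, m3, d12, d13, d23⟩ := two_lt_card_iff.1 (by simpa using hgt)
      simp only [mem_filter] at m1 m2 m3
      exact hth (theta23 G hxy.2.2 (hA _ hxy.1 _ hxy.2.1) m1.2.1.symm m2.2.1.symm m3.2.1.symm
        m1.2.2 m2.2.2 m3.2.2 d12 d13 d23 (hW _ m1.1 _ m2.1) (hW _ m1.1 _ m3.1) (hW _ m2.1 _ m3.1))
    · rw [if_neg hH, mul_zero, Nat.le_zero, card_eq_zero, filter_eq_empty_iff]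
      intro b hb hbb
      exact hH ⟨hxy.2.2, hxy.1, hxy.2.1, b, hb, hbb.1, hbb.2⟩
  have hr2 := sum_le_sum hr
  rw [← hcount, ← mul_sum] at hr2
  have hv : ∑ xy ∈ A.offDiag, (if H.Adj xy.1 xy.2 then 1 else 0) ≤ vol H A := by
    calc ∑ xy ∈ A.offDiag, (if H.Adj xy.1 xy.2 then 1 else 0)
        ≤ ∑ xy ∈ A ×ˢ A, (if H.Adj xy.1 xy.2 then 1 else 0) :=
          sum_le_sum_of_subset (fun z hz => by
            rw [mem_offDiag] at hz; exact mem_product.2 ⟨hz.1, hz.2.1⟩)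
      _ = vol H A := by
          rw [sum_product]
          unfold vol dg
          refine sum_congr rfl fun x _ => ?_
          rw [card_filter]
          refine sum_congr rfl fun i _ => ?_
          by_cases h : H.Adj x i
          · rw [if_pos h, if_pos h]
          · rw [if_neg h, if_neg h]
  have hnd : ¬ Degen H A 2 := by
    intro hd
    have := vol_le hd
    omega
  obtain ⟨T, hTA, hTn, d', hd', hmin, -⟩ := exists_dense hnd
  exact hth (theta_of_min_deg hsub T hTn (fun v hv => by have := hmin v hv; omega))



/-- Every pair is kept and nothing conflicts. -/
def Good (N : Finset V) (U : V → V → Finset V) (R : Finset V) : Prop :=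
  ∃ x ∈ N, ∃ y ∈ N, x ≠ y ∧ x ∈ R ∧ y ∈ R ∧ Disjoint (U x y) R

/-- indicator of inclusion -/
noncomputable def ind (T R : Finset V) : ℝ := if T ⊆ R then 1 else 0

lemma ind_nonneg (T R : Finset V) : 0 ≤ ind T R := by unfold ind; split_ifs <;> norm_num

lemma good_pointwise (N : Finset V) (U : V → V → Finset V)
    (hN : ∀ x ∈ N, ∀ y ∈ N, x ≠ y → ∀ z ∈ N, z ≠ x → z ≠ y → z ∈ U x y) (R : Finset V) :
    ∑ z ∈ N.offDiag, (ind {z.1, z.2} R - ∑ u ∈ U z.1 z.2, ind {z.1, z.2, u} R)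
      ≤ 2 * (if Good N U R then 1 else 0) := by
  have hterm : ∀ z ∈ N.offDiag, (ind {z.1, z.2} R - ∑ u ∈ U z.1 z.2, ind {z.1, z.2, u} R)
      ≤ if (z.1 ∈ R ∧ z.2 ∈ R ∧ Disjoint (U z.1 z.2) R) then 1 else 0 := by
    intro z hz
    have hs : 0 ≤ ∑ u ∈ U z.1 z.2, ind {z.1, z.2, u} R := sum_nonneg fun _ _ => ind_nonneg _ _
    split_ifs with h
    · have : ind {z.1, z.2} R ≤ 1 := by unfold ind; split_ifs <;> norm_num
      linarith
    · by_cases h1 : z.1 ∈ R ∧ z.2 ∈ R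
      · have h2 : ¬ Disjoint (U z.1 z.2) R := fun h' => h ⟨h1.1, h1.2, h'⟩
        rw [Finset.not_disjoint_iff] at h2
        obtain ⟨u, hu, huR⟩ := h2
        have h3 : ind {z.1, z.2, u} R ≤ ∑ u ∈ U z.1 z.2, ind {z.1, z.2, u} R :=
          single_le_sum (f := fun u => ind {z.1, z.2, u} R) (fun _ _ => ind_nonneg _ _) hu
        have h4 : ind {z.1, z.2, u} R = 1 := by
          unfold ind; rw [if_pos]; intro t ht; simp at ht; grind
        have : ind {z.1, z.2} R ≤ 1 := by unfold ind; split_ifs <;> norm_num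
        linarith
      · have : ind {z.1, z.2} R = 0 := by
          unfold ind; rw [if_neg]; intro h'; exact h1 ⟨h' (by simp), h' (by simp)⟩
        linarith
  refine (sum_le_sum hterm).trans ?_
  by_cases hg : Good N U R
  · rw [if_pos hg]
    obtain ⟨x, hx, y, hy, hxy, hxR, hyR, hd⟩ := hg
    rw [← sum_filter, sum_const, nsmul_eq_mul]
    have : (N.offDiag.filter (fun z => z.1 ∈ R ∧ z.2 ∈ R ∧ Disjoint (U z.1 z.2) R)) ⊆
        ({x, y} : Finset V).offDiag := by
      intro z hz
      rw [mem_filter, mem_offDiag] at hz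
      have key : ∀ t ∈ N, t ∈ R → t = x ∨ t = y := by
        intro t ht htR
        by_contra hc
        push Not at hc
        exact (Finset.disjoint_left.1 hd) (hN x hx y hy hxy t ht hc.1 hc.2) htR
      rw [mem_offDiag]
      simp only [mem_insert, mem_singleton]
      exact ⟨key _ hz.1.1 hz.2.1, key _ hz.1.2.1 hz.2.2.1, hz.1.2.2⟩
    have h2 := card_le_card this
    rw [offDiag_card, card_pair hxy] at h2
    have : ((#(N.offDiag.filter (fun z => z.1 ∈ R ∧ z.2 ∈ R ∧ Disjoint (U z.1 z.2) R)) : ℕ) : ℝ)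
      ≤ 2 := by exact_mod_cast h2
    linarith
  · rw [if_neg hg]
    refine le_of_eq ?_
    rw [mul_zero]
    refine sum_eq_zero fun z hz => ?_
    rw [if_neg]
    rintro ⟨h1, h2, h3⟩
    rw [mem_offDiag] at hz
    exact hg ⟨z.1, hz.1, z.2, hz.2.1, hz.2.2, h1, h2, h3⟩

lemma good_exp [Fintype V] (w : Finset V → ℝ) (p : ℝ) (hw : ∀ R, 0 ≤ w R)
    (hp0 : 0 ≤ p)
    (hT : ∀ T, ∑ R, w R * ind T R = p ^ T.card)
    (N : Finset V) (U : V → V → Finset V)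
    (hN : ∀ x ∈ N, ∀ y ∈ N, x ≠ y → ∀ z ∈ N, z ≠ x → z ≠ y → z ∈ U x y)
    (hU : ∀ x ∈ N, ∀ y ∈ N, x ≠ y → x ∉ U x y ∧ y ∉ U x y) (m : ℕ)
    (hm : ∀ x ∈ N, ∀ y ∈ N, x ≠ y → (U x y).card ≤ m) (hmp : m * p ≤ 1 / 2) :
    (#N.offDiag : ℝ) * (p ^ 2 / 2) ≤ 2 * ∑ R, w R * (if Good N U R then 1 else 0) := by
  calc (#N.offDiag : ℝ) * (p ^ 2 / 2) = ∑ z ∈ N.offDiag, p ^ 2 / 2 := by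
        rw [sum_const, nsmul_eq_mul]
    _ ≤ ∑ z ∈ N.offDiag, ∑ R, w R * (ind {z.1, z.2} R - ∑ u ∈ U z.1 z.2, ind {z.1, z.2, u} R) := by
        refine sum_le_sum fun z hz => ?_
        rw [mem_offDiag] at hz
        obtain ⟨h1, h2, h3⟩ := hz
        simp_rw [mul_sub, mul_sum]
        rw [sum_sub_distrib, sum_comm, hT, card_pair h3]
        have : ∀ u ∈ U z.1 z.2, ∑ R, w R * ind {z.1, z.2, u} R = p ^ 3 := by
          intro u hu
          rw [hT]
          congr 1
          have := hU _ h1 _ h2 h3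
          exact card_eq_three.2 ⟨z.1, z.2, u, h3, fun h => this.1 (h ▸ hu),
            fun h => this.2 (h ▸ hu), rfl⟩
        rw [sum_congr rfl this, sum_const, nsmul_eq_mul]
        have h4 : ((U z.1 z.2).card : ℝ) ≤ m := by exact_mod_cast hm _ h1 _ h2 h3
        have h5 : ((U z.1 z.2).card : ℝ) * p ≤ 1 / 2 :=
          (mul_le_mul_of_nonneg_right h4 hp0).trans hmp
        nlinarith [mul_le_mul_of_nonneg_right h5 (sq_nonneg p)]
    _ = ∑ R, w R * ∑ z ∈ N.offDiag, (ind {z.1, z.2} R - ∑ u ∈ U z.1 z.2, ind {z.1, z.2, u} R) := by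
        rw [sum_comm]; simp_rw [mul_sum]
    _ ≤ ∑ R, w R * (2 * (if Good N U R then 1 else 0)) :=
        sum_le_sum fun R _ => mul_le_mul_of_nonneg_left (good_pointwise N U hN R) (hw R)
    _ = _ := by rw [mul_sum]; refine sum_congr rfl fun R _ => by ring

lemma exists_pos_of_exp [Fintype V] (w f : Finset V → ℝ) (hw : ∀ R, 0 ≤ w R)
    (h : 0 < ∑ R, w R * f R) : ∃ R, 0 < f R := by
  by_contra hc
  push Not at hc
  have : ∑ R, w R * f R ≤ 0 := sum_nonpos fun R _ => mul_nonpos_of_nonneg_of_nonpos (hw R) (hc R)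
  linarith

lemma exp_card [Fintype V] (w : Finset V → ℝ) (p : ℝ)
    (hT : ∀ T, ∑ R, w R * ind T R = p ^ T.card) (S : Finset V) :
    ∑ R, w R * ((S ∩ R).card : ℝ) = p * S.card := by
  have : ∀ R : Finset V, ((S ∩ R).card : ℝ) = ∑ v ∈ S, ind {v} R := by
    intro R
    unfold ind
    simp only [singleton_subset_iff]
    rw [← sum_filter, sum_const, nsmul_eq_mul, mul_one]
    congr 2
  simp_rw [this, mul_sum]
  rw [sum_comm]
  simp_rw [hT]
  simp [mul_comm]


lemma low_degree_half {G : SimpleGraph V} {S : Finset V} {d : ℕ} (hd : 0 < d) (h : Degen G S d) :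
    S.card ≤ 2 * (S.filter (fun v => dg G S v ≤ 4 * d)).card := by
  have h1 := vol_le h
  have h2 : (S.filter (fun v => ¬ dg G S v ≤ 4 * d)).card * (4 * d) ≤ vol G S := by
    calc _ ≤ ∑ v ∈ S.filter (fun v => ¬ dg G S v ≤ 4 * d), dg G S v := by
          rw [← smul_eq_mul]
          exact card_nsmul_le_sum _ _ _ fun v hv => by have := (mem_filter.1 hv).2; omega
      _ ≤ _ := sum_le_sum_of_subset (filter_subset _ _)
  have h3 := card_filter_add_card_filter_not (s := S) (fun v => dg G S v ≤ 4 * d)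
  have h4 : (2 * (S.filter (fun v => ¬ dg G S v ≤ 4 * d)).card) * (2 * d) ≤ S.card * (2 * d) := by
    nlinarith
  have h5 := Nat.le_of_mul_le_mul_right h4 (by omega)
  omega

/-- conflict sets -/
noncomputable def UU (G : SimpleGraph V) (S : Finset V) (r : V → ℕ) (v x y : V) : Finset V :=
  (((S.filter (fun u => G.Adj v u)) ∪ {v}) ∪ (out G S r x ∪ out G S r y)) \ {x, y}

lemma exists_sample [Fintype V] {G : SimpleGraph V} {S : Finset V} {d : ℕ} (hd : 2 ≤ d)
    (hne : S.Nonempty) (hmin : ∀ v ∈ S, d ≤ dg G S v) (hdeg : Degen G S d) (r : V → ℕ)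
    (ho : ∀ v ∈ S, (out G S r v).card ≤ d) :
    ∃ R : Finset V, d * (S ∩ R).card < 448 * ((S.filter (fun v => dg G S v ≤ 4 * d)).filter
      (fun v => Good (S.filter (fun u => G.Adj v u)) (UU G S r v) R)).card := by
  set L := S.filter (fun v => dg G S v ≤ 4 * d) with hL
  have hLc := low_degree_half (by omega) hdeg
  rw [← hL] at hLc
  have hdR : (2 : ℝ) ≤ d := by exact_mod_cast hd
  set p : ℝ := 1 / (14 * d) with hp
  have hp0 : 0 < p := by positivity
  have hpd : p * d = 1 / 14 := by rw [hp]; field_simp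
  have hp1 : p ≤ 1 := by nlinarith
  obtain ⟨w, hw, hT'⟩ := sampling V p hp0.le hp1
  have hT : ∀ T : Finset V, ∑ R, w R * ind T R = p ^ T.card := hT'
  have hv : ∀ v ∈ L, (1 / 1568 : ℝ) ≤
      ∑ R, w R * (if Good (S.filter (fun u => G.Adj v u)) (UU G S r v) R then 1 else 0) := by
    intro v hv
    rw [hL, mem_filter] at hv
    have := good_exp w p hw hp0.le hT (S.filter (fun u => G.Adj v u)) (UU G S r v)
      (by
        intro x hx y hy hxy z hz hzx hzy
        unfold UU
        simp only [mem_sdiff, mem_union, mem_insert, mem_singleton]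
        exact ⟨Or.inl (Or.inl hz), by tauto⟩)
      (by
        intro x hx y hy hxy
        unfold UU
        simp)
      (7 * d)
      (by
        intro x hx y hy hxy
        refine (card_le_card sdiff_subset).trans ?_
        refine (card_union_le _ _).trans ?_
        have h1 := card_union_le (S.filter (fun u => G.Adj v u)) {v}
        have h2 := card_union_le (out G S r x) (out G S r y)
        have h3 := ho x (mem_filter.1 hx).1
        have h4 := ho y (mem_filter.1 hy).1
        have h5 : (S.filter (fun u => G.Adj v u)).card ≤ 4 * d := hv.2
        rw [card_singleton] at h1
        omega)
      (by push_cast; nlinarith)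
    have hm : d ≤ (S.filter (fun u => G.Adj v u)).card := hmin v hv.1
    have hm' : (d : ℝ) ≤ (S.filter (fun u => G.Adj v u)).card := by exact_mod_cast hm
    have hod : ((#(S.filter (fun u => G.Adj v u)).offDiag : ℕ) : ℝ) =
        (S.filter (fun u => G.Adj v u)).card ^ 2 - (S.filter (fun u => G.Adj v u)).card := by
      rw [offDiag_card, Nat.cast_sub (Nat.le_mul_self _)]; push_cast; ring
    rw [hod] at this
    have h6 : (d : ℝ) ^ 2 / 2 ≤
        (S.filter (fun u => G.Adj v u)).card ^ 2 - (S.filter (fun u => G.Adj v u)).card := by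
      nlinarith
    have h7 : (d : ℝ) ^ 2 / 2 * (p ^ 2 / 2) = 1 / 784 := by
      have : (d : ℝ) ^ 2 / 2 * (p ^ 2 / 2) = (p * d) ^ 2 / 4 := by ring
      rw [this, hpd]; norm_num
    have h8 := mul_le_mul_of_nonneg_right h6 (show 0 ≤ p ^ 2 / 2 by positivity)
    linarith
  have hB : ∀ R : Finset V, ((L.filter
      (fun v => Good (S.filter (fun u => G.Adj v u)) (UU G S r v) R)).card : ℝ) =
      ∑ v ∈ L, (if Good (S.filter (fun u => G.Adj v u)) (UU G S r v) R then (1 : ℝ) else 0) := by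
    intro R
    rw [← sum_filter, sum_const, nsmul_eq_mul, mul_one]
  obtain ⟨R, hR⟩ := exists_pos_of_exp w (fun R => 448 * ((L.filter
      (fun v => Good (S.filter (fun u => G.Adj v u)) (UU G S r v) R)).card : ℝ)
      - d * ((S ∩ R).card : ℝ)) hw (by
    have h1 : ∑ R, w R * (448 * ((L.filter
      (fun v => Good (S.filter (fun u => G.Adj v u)) (UU G S r v) R)).card : ℝ)
      - d * ((S ∩ R).card : ℝ)) = 448 * ∑ v ∈ L, ∑ R, w R *
        (if Good (S.filter (fun u => G.Adj v u)) (UU G S r v) R then (1 : ℝ) else 0)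
        - d * (p * S.card) := by
      rw [← exp_card w p hT S, sum_comm, mul_sum, mul_sum, ← sum_sub_distrib]
      refine sum_congr rfl fun R _ => ?_
      rw [hB, ← mul_sum]
      ring
    rw [h1]
    have h2 : (L.card : ℝ) * (1 / 1568) ≤ ∑ v ∈ L, ∑ R, w R *
        (if Good (S.filter (fun u => G.Adj v u)) (UU G S r v) R then (1 : ℝ) else 0) := by
      rw [← nsmul_eq_mul]
      exact card_nsmul_le_sum _ _ _ hv
    have h3 : (S.card : ℝ) ≤ 2 * L.card := by exact_mod_cast hLc
    have h4 : (0 : ℝ) < S.card := by exact_mod_cast hne.card_pos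
    have h5 : (d : ℝ) * (p * S.card) = S.card / 14 := by
      rw [← mul_assoc, mul_comm (d : ℝ), hpd]; ring
    rw [h5]
    linarith)
  refine ⟨R, ?_⟩
  have hR' : (d : ℝ) * ((S ∩ R).card : ℝ) < 448 * ((L.filter
      (fun v => Good (S.filter (fun u => G.Adj v u)) (UU G S r v) R)).card : ℝ) := by linarith
  exact_mod_cast hR'

lemma step2_core [Fintype V] {G : SimpleGraph V} {S : Finset V} {d K : ℕ} (hd : 2 ≤ d)
    (hK : K = 14336) (hdK : K * (4 ^ K + 1) ≤ 4 * d)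
    (hne : S.Nonempty) (hmin : ∀ v ∈ S, d ≤ dg G S v) (hdeg : Degen G S d)
    (htf : TriFree G S) : Paper.ContainsTheta G := by
  obtain ⟨r, hr, ho⟩ := exists_rank G d S hdeg
  obtain ⟨R, hR⟩ := exists_sample hd hne hmin hdeg r ho
  set B := ((S.filter (fun v => dg G S v ≤ 4 * d)).filter
      (fun v => Good (S.filter (fun u => G.Adj v u)) (UU G S r v) R)) with hB
  have hBS : B ⊆ S := (filter_subset _ _).trans (filter_subset _ _)
  obtain ⟨W, hWB, hWst, hWc⟩ := aks G B (4 * d) K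
    (fun a ha b hb c hc => htf a (hBS ha) b (hBS hb) c (hBS hc))
    (fun v hv => (dg_mono hBS v).trans (mem_filter.1 (mem_filter.1 hv).1).2) hdK
  set A := (S ∩ R).filter (fun u => Disjoint (out G S r u) R) with hA
  have hgood : ∀ v ∈ W, v ∈ S ∧ v ∉ R ∧ ∃ x y, x ≠ y ∧ A.filter (fun u => G.Adj v u) = {x, y} := by
    intro v hvW
    have hvB := hWB hvW
    have hvS := hBS hvB
    obtain ⟨x, hx, y, hy, hxy, hxR, hyR, hdis⟩ := (mem_filter.1 hvB).2
    rw [mem_filter] at hx hy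
    have hU : ∀ z, z ∈ R → z ≠ x → z ≠ y →
        ¬ (z ∈ S ∧ G.Adj v z) ∧ z ≠ v ∧ z ∉ out G S r x ∧ z ∉ out G S r y := by
      intro z hzR hzx hzy
      have := fun h => Finset.disjoint_left.1 hdis h hzR
      unfold UU at this
      simp only [mem_sdiff, mem_union, mem_insert, mem_singleton, mem_filter] at this
      refine ⟨fun h => this ⟨by tauto, by tauto⟩, fun h => this ⟨by tauto, by tauto⟩,
        fun h => this ⟨by tauto, by tauto⟩, fun h => this ⟨by tauto, by tauto⟩⟩
    have hnxy : ¬ G.Adj x y := fun h => htf v hvS x hx.1 y hy.1 hx.2 h hy.2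
    have hxA : Disjoint (out G S r x) R := by
      rw [Finset.disjoint_left]
      intro z hz hzR
      have hz' := (mem_filter.1 hz).2.1
      exact (hU z hzR hz'.ne' (fun h => hnxy (h ▸ hz'))).2.2.1 hz
    have hyA : Disjoint (out G S r y) R := by
      rw [Finset.disjoint_left]
      intro z hz hzR
      have hz' := (mem_filter.1 hz).2.1
      exact (hU z hzR (fun h => hnxy (h ▸ hz').symm) hz'.ne').2.2.2 hz
    refine ⟨hvS, fun hvR => (hU v hvR hx.2.ne hy.2.ne).2.1 rfl, x, y, hxy, ?_⟩
    ext z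
    simp only [mem_filter, mem_insert, mem_singleton, hA, mem_inter]
    constructor
    · rintro ⟨⟨⟨hzS, hzR⟩, hzd⟩, hvz⟩
      by_contra hc
      push Not at hc
      exact (hU z hzR hc.1 hc.2).1 ⟨hzS, hvz⟩
    · rintro (rfl | rfl)
      · exact ⟨⟨⟨hx.1, hxR⟩, hxA⟩, hx.2⟩
      · exact ⟨⟨⟨hy.1, hyR⟩, hyA⟩, hy.2⟩
  refine theta_of_struct G A W ?_ ?_ hWst ?_ ?_
  · rw [Finset.disjoint_right]
    intro v hv hvA
    exact (hgood v hv).2.1 (mem_inter.1 (mem_filter.1 hvA).1).2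
  · intro a ha b hb hab
    rw [hA, mem_filter, mem_inter] at ha hb
    have hne : r a ≠ r b := fun h => hab.ne (hr ha.1.1 hb.1.1 h)
    rcases lt_or_gt_of_ne hne with h | h
    · exact Finset.disjoint_left.1 ha.2 (mem_filter.2 ⟨hb.1.1, hab, h⟩) hb.1.2
    · exact Finset.disjoint_left.1 hb.2 (mem_filter.2 ⟨ha.1.1, hab.symm, h⟩) ha.1.2
  · intro v hv
    obtain ⟨_, _, x, y, hxy, h⟩ := hgood v hv
    rw [h, card_pair hxy]
  · have h1 : A.card ≤ (S ∩ R).card := card_le_card (filter_subset _ _)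
    rw [hK] at hWc
    have h2 : d * (4 * (S ∩ R).card) < d * W.card := by nlinarith
    have h3 := lt_of_mul_lt_mul_left h2 (Nat.zero_le d)
    omega

lemma step2 : ∃ D : ℕ, 1 ≤ D ∧ ∀ (V : Type) [Fintype V] (G : SimpleGraph V),
    ¬ Paper.ContainsTheta G → ∀ S : Finset V, TriFree G S → vol G S ≤ 2 * (D * S.card) := by
  obtain ⟨K, hK⟩ : ∃ K : ℕ, K = 14336 := ⟨_, rfl⟩
  refine ⟨K * (4 ^ K + 1) + 2, by omega, fun V _ G hG S hS => ?_⟩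
  apply vol_le
  by_contra hnd
  obtain ⟨T, hTS, hTn, d, hd, hmin, hdeg⟩ := exists_dense hnd
  exact hG (step2_core (by omega) hK (by omega) hTn hmin hdeg
    (fun a ha b hb c hc => hS a (hTS ha) b (hTS hb) c (hTS hc)))


lemma common_le {G : SimpleGraph V} (hG : ¬ Paper.ContainsTheta G) {w : ℕ}
    (hw : ∀ K : Finset V, G.IsClique K → K.card ≤ w) {x y : V} (hxy : x ≠ y) (hn : ¬ G.Adj x y)
    (C : Finset V) (hC : ∀ u ∈ C, G.Adj u x ∧ G.Adj u y) : C.card ≤ w * (w + 1) := by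
  have h1 : ∀ u ∈ C, (C.filter (fun y => ¬ G.Adj u y)).card ≤ w + 1 := by
    intro u hu
    have hcl : G.IsClique ((C.filter (fun y => ¬ G.Adj u y)).erase u : Finset V) := by
      intro a ha b hb hab
      rw [mem_coe, mem_erase, mem_filter] at ha hb
      by_contra hadj
      exact hG (theta23 G hxy hn (hC u hu).1.symm (hC a ha.2.1).1.symm (hC b hb.2.1).1.symm
        (hC u hu).2 (hC a ha.2.1).2 (hC b hb.2.1).2 ha.1.symm hb.1.symm hab ha.2.2 hb.2.2 hadj)
    have := hw _ hcl
    have h2 := pred_card_le_card_erase (s := C.filter (fun y => ¬ G.Adj u y)) (a := u)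
    omega
  have h2 := turan G w C (fun K _ => hw K)
  have h3 := sum_le_card_nsmul C _ _ h1
  rw [smul_eq_mul] at h3
  rcases Nat.eq_zero_or_pos C.card with h | h
  · omega
  · have : C.card * C.card ≤ C.card * (w * (w + 1)) := by nlinarith [Nat.mul_le_mul_left w h3]
    exact Nat.le_of_mul_le_mul_left this h

lemma vol_le_sq (G : SimpleGraph V) (N : Finset V) : vol G N ≤ N.card ^ 2 := by
  rw [sq, ← smul_eq_mul]
  exact sum_le_card_nsmul _ _ _ fun v _ => card_le_card (filter_subset _ _)

lemma sparse {G : SimpleGraph V} (hG : ¬ Paper.ContainsTheta G) {w : ℕ}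
    (hw : ∀ K : Finset V, G.IsClique K → K.card ≤ w) (N : Finset V) :
    (vol G N) ^ 2 ≤ N.card ^ 3 * (w * (w ^ 2 + w + 1)) := by
  have hcs : (vol G N) ^ 2 ≤ N.card * ∑ u ∈ N, (dg G N u) ^ 2 := sq_sum_le_card_mul_sum_sq
  have h1 : ∀ u ∈ N, (dg G N u) ^ 2 ≤ w * ∑ x ∈ N, ∑ y ∈ N,
      (if ¬ G.Adj x y ∧ G.Adj u x ∧ G.Adj u y then 1 else 0) := by
    intro u hu
    refine (turan G w (N.filter (fun x => G.Adj u x)) (fun K _ => hw K)).trans ?_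
    refine Nat.mul_le_mul_left _ ?_
    rw [sum_filter]
    refine sum_le_sum fun x _ => ?_
    split_ifs with h
    · rw [filter_filter, card_filter]
      refine sum_le_sum fun y _ => ?_
      split_ifs with h1 h2 <;> simp_all
    · exact Nat.zero_le _
  have h2 : ∑ u ∈ N, ∑ x ∈ N, ∑ y ∈ N,
      (if ¬ G.Adj x y ∧ G.Adj u x ∧ G.Adj u y then 1 else 0) ≤
      vol G N + N.card ^ 2 * (w * (w + 1)) := by
    calc _ = ∑ x ∈ N, ∑ y ∈ N, ∑ u ∈ N,
          (if ¬ G.Adj x y ∧ G.Adj u x ∧ G.Adj u y then 1 else 0) := by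
          rw [sum_comm]
          refine sum_congr rfl fun x _ => ?_
          rw [sum_comm]
      _ ≤ ∑ x ∈ N, ∑ y ∈ N, ((if x = y then dg G N x else 0) + w * (w + 1)) := by
          refine sum_le_sum fun x _ => sum_le_sum fun y _ => ?_
          rw [← card_filter]
          by_cases hxy : x = y
          · subst hxy
            rw [if_pos rfl]
            refine le_trans (card_le_card ?_) (Nat.le_add_right _ _)
            intro u hu
            rw [mem_filter] at hu ⊢
            exact ⟨hu.1, hu.2.2.1.symm⟩
          · rw [if_neg hxy, zero_add]
            by_cases hn : G.Adj x y
            · simp [hn]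
            · exact common_le hG hw hxy hn _ fun u hu => (mem_filter.1 hu).2.2
      _ = _ := by
          simp_rw [sum_add_distrib, sum_ite_eq, sum_const, smul_eq_mul]
          rw [sum_congr rfl (fun x hx => if_pos hx)]
          unfold vol
          ring
  have h3 := sum_le_sum h1
  rw [← mul_sum] at h3
  have h4 := vol_le_sq G N
  calc _ ≤ N.card * (w * (vol G N + N.card ^ 2 * (w * (w + 1)))) :=
        hcs.trans (Nat.mul_le_mul_left _ (h3.trans (Nat.mul_le_mul_left _ h2)))
    _ ≤ N.card * (w * (N.card ^ 2 + N.card ^ 2 * (w * (w + 1)))) := by gcongr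
    _ = _ := by ring


/-- `u` sees an edge inside the sampled part of `O`. -/
def Bad (G : SimpleGraph V) (O R : Finset V) : Prop :=
  ∃ a ∈ O, ∃ b ∈ O, a ∈ R ∧ b ∈ R ∧ G.Adj a b

noncomputable def RR (G : SimpleGraph V) (S : Finset V) (r : V → ℕ) (R : Finset V) : Finset V :=
  (S ∩ R).filter (fun u => ¬ Bad G (out G S r u) R)

lemma mem_RR {G : SimpleGraph V} {S : Finset V} {r : V → ℕ} {R : Finset V} {u : V} :
    u ∈ RR G S r R ↔ (u ∈ S ∧ u ∈ R) ∧ ¬ Bad G (out G S r u) R := by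
  unfold RR; rw [mem_filter, mem_inter]

lemma RR_triFree {G : SimpleGraph V} {S : Finset V} {r : V → ℕ} (hr : Set.InjOn r S)
    (R : Finset V) : TriFree G (RR G S r R) := by
  have key : ∀ a ∈ RR G S r R, ∀ b ∈ RR G S r R, ∀ c ∈ RR G S r R,
      G.Adj a b → G.Adj b c → G.Adj a c → r a < r b → r a < r c → False := by
    intro a ha b hb c hc hab hbc hac h1 h2
    rw [mem_RR] at ha hb hc
    exact ha.2 ⟨b, mem_filter.2 ⟨hb.1.1, hab, h1⟩, c, mem_filter.2 ⟨hc.1.1, hac, h2⟩,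
      hb.1.2, hc.1.2, hbc⟩
  intro a ha b hb c hc hab hbc hac
  have ha' := (mem_RR.1 ha).1.1
  have hb' := (mem_RR.1 hb).1.1
  have hc' := (mem_RR.1 hc).1.1
  have n1 : r a ≠ r b := fun h => hab.ne (hr ha' hb' h)
  have n2 : r b ≠ r c := fun h => hbc.ne (hr hb' hc' h)
  have n3 : r a ≠ r c := fun h => hac.ne (hr ha' hc' h)
  by_cases h1 : r a < r b ∧ r a < r c
  · exact key a ha b hb c hc hab hbc hac h1.1 h1.2
  by_cases h2 : r b < r a ∧ r b < r c
  · exact key b hb a ha c hc hab.symm hac hbc h2.1 h2.2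
  · exact key c hc a ha b hb hac.symm hab hbc.symm (by omega) (by omega)

/-- number of sampled adjacent pairs -/
noncomputable def QQ (G : SimpleGraph V) (O : Finset V) (u v : V) (R : Finset V) : ℝ :=
  ∑ a ∈ O, ∑ b ∈ O, if G.Adj a b then ind {u, v, a, b} R else 0

lemma QQ_nonneg (G : SimpleGraph V) (O : Finset V) (u v : V) (R : Finset V) : 0 ≤ QQ G O u v R :=
  sum_nonneg fun a _ => sum_nonneg fun b _ => by
    split_ifs
    · exact ind_nonneg _ _
    · exact le_rfl

lemma one_le_QQ {G : SimpleGraph V} {O : Finset V} {u v : V} {R : Finset V} (hu : u ∈ R)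
    (hv : v ∈ R) (h : Bad G O R) : 1 ≤ QQ G O u v R := by
  obtain ⟨a, ha, b, hb, haR, hbR, hab⟩ := h
  have h0 : ∀ a b, 0 ≤ (if G.Adj a b then ind {u, v, a, b} R else 0) := fun a b => by
    split_ifs
    · exact ind_nonneg _ _
    · exact le_rfl
  have h1 : (if G.Adj a b then ind {u, v, a, b} R else 0) = 1 := by
    rw [if_pos hab]; unfold ind; rw [if_pos]; intro t ht; simp at ht; grind
  rw [← h1]
  unfold QQ
  refine (single_le_sum (f := fun b => if G.Adj a b then ind {u, v, a, b} R else 0)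
    (fun b _ => h0 a b) hb).trans ?_
  exact single_le_sum (f := fun a => ∑ b ∈ O, if G.Adj a b then ind {u, v, a, b} R else 0)
    (fun a _ => sum_nonneg fun b _ => h0 a b) ha

lemma edge_pointwise {G : SimpleGraph V} {S : Finset V} {r : V → ℕ} {u v : V} (hu : u ∈ S)
    (hv : v ∈ S) (R : Finset V) :
    ind {u, v} R - QQ G (out G S r u) u v R - QQ G (out G S r v) u v R ≤
      if u ∈ RR G S r R ∧ v ∈ RR G S r R then 1 else 0 := by
  have h1 := QQ_nonneg G (out G S r u) u v R
  have h2 := QQ_nonneg G (out G S r v) u v R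
  have h3 : ind {u, v} R ≤ 1 := by unfold ind; split_ifs <;> norm_num
  split_ifs with h
  · linarith
  · by_cases hR : u ∈ R ∧ v ∈ R
    · rw [mem_RR, mem_RR] at h
      by_cases hb : Bad G (out G S r u) R
      · have := one_le_QQ hR.1 hR.2 hb
        linarith
      · have hb' : Bad G (out G S r v) R := by tauto
        have := one_le_QQ hR.1 hR.2 hb'
        linarith
    · have : ind {u, v} R = 0 := by
        unfold ind; rw [if_neg]; intro h'; exact hR ⟨h' (by simp), h' (by simp)⟩
      linarith

lemma vol_eq_sum (G : SimpleGraph V) (O : Finset V) :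
    (vol G O : ℝ) = ∑ a ∈ O, ∑ b ∈ O, if G.Adj a b then (1 : ℝ) else 0 := by
  unfold vol dg
  push_cast
  refine sum_congr rfl fun a _ => ?_
  rw [card_filter]; push_cast; rfl

lemma QQ_exp [Fintype V] {G : SimpleGraph V} (w : Finset V → ℝ) (p : ℝ)
    (hp0 : 0 ≤ p) (hT : ∀ T, ∑ R, w R * ind T R = p ^ T.card)
    (O : Finset V) (u v : V) (huv : u ≠ v) (hu : u ∉ O) :
    ∑ R, w R * QQ G O u v R ≤ p ^ 4 * vol G O + (if v ∈ O then 2 * p ^ 3 * dg G O v else 0) := by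
  have h1 : ∑ R, w R * QQ G O u v R =
      ∑ a ∈ O, ∑ b ∈ O, if G.Adj a b then p ^ (({u, v, a, b} : Finset V).card) else 0 := by
    unfold QQ
    simp_rw [mul_sum]
    rw [sum_comm]
    refine sum_congr rfl fun a _ => ?_
    rw [sum_comm]
    refine sum_congr rfl fun b _ => ?_
    split_ifs
    · exact hT _
    · simp
  rw [h1]
  have h2 : ∀ a ∈ O, ∀ b ∈ O, (if G.Adj a b then p ^ (({u, v, a, b} : Finset V).card) else 0) ≤
      p ^ 4 * (if G.Adj a b then 1 else 0) + ((if v = a then (if G.Adj v b then p ^ 3 else 0) else 0)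
        + (if v = b then (if G.Adj v a then p ^ 3 else 0) else 0)) := by
    intro a ha b hb
    have hua : u ≠ a := fun h => hu (h ▸ ha)
    have hub : u ≠ b := fun h => hu (h ▸ hb)
    have p3 : 0 ≤ p ^ 3 := by positivity
    have p4 : 0 ≤ p ^ 4 := by positivity
    by_cases hab : G.Adj a b
    · have habn := hab.ne
      simp only [if_pos hab]
      by_cases hva : v = a
      · subst hva
        have hc : ({u, v, v, b} : Finset V).card = 3 := by
          rw [card_eq_three]; exact ⟨u, v, b, huv, hub, habn, by ext; simp⟩
        rw [hc, if_pos rfl, if_pos hab, if_neg habn]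
        linarith
      · by_cases hvb : v = b
        · subst hvb
          have hc : ({u, v, a, v} : Finset V).card = 3 := by
            rw [card_eq_three]; exact ⟨u, v, a, huv, hua, hva, by ext; simp; tauto⟩
          rw [hc, if_neg hva, if_pos rfl, if_pos hab.symm]
          linarith
        · have hc : ({u, v, a, b} : Finset V).card = 4 := by
            rw [card_insert_of_notMem (by simp [huv, hua, hub]),
              card_insert_of_notMem (by simp [hva, hvb]), card_pair habn]
          rw [hc, if_neg hva, if_neg hvb]
          linarith
    · simp only [if_neg hab]
      have hnn : ∀ (P Q : Prop) [Decidable P] [Decidable Q],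
        0 ≤ (if P then (if Q then p ^ 3 else 0) else 0) := by
        intro P Q _ _; split_ifs <;> linarith
      have := hnn (v = a) (G.Adj v b)
      have := hnn (v = b) (G.Adj v a)
      linarith
  refine (sum_le_sum fun a ha => sum_le_sum (h2 a ha)).trans ?_
  simp_rw [sum_add_distrib, ← mul_sum]
  rw [← vol_eq_sum]
  have hd : (∑ b ∈ O, if G.Adj v b then p ^ 3 else 0) = p ^ 3 * dg G O v := by
    rw [← sum_filter, sum_const, nsmul_eq_mul, mul_comm]; rfl
  have e1 : (∑ a ∈ O, ∑ b ∈ O, if v = a then (if G.Adj v b then p ^ 3 else 0) else 0) =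
      if v ∈ O then p ^ 3 * dg G O v else 0 := by
    rw [sum_comm]
    simp_rw [sum_ite_eq]
    split_ifs
    · exact hd
    · simp
  have e2 : (∑ a ∈ O, ∑ b ∈ O, if v = b then (if G.Adj v a then p ^ 3 else 0) else 0) =
      if v ∈ O then p ^ 3 * dg G O v else 0 := by
    simp_rw [sum_ite_eq]
    split_ifs
    · exact hd
    · simp
  rw [e1, e2]
  split_ifs <;> linarith

lemma edge_exp [Fintype V] {G : SimpleGraph V} {S : Finset V} {r : V → ℕ}
    (w : Finset V → ℝ) (p m : ℝ) (hw : ∀ R, 0 ≤ w R)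
    (hp0 : 0 ≤ p) (hT : ∀ T, ∑ R, w R * ind T R = p ^ T.card)
    (hm : ∀ u ∈ S, (vol G (out G S r u) : ℝ) ≤ m) {u v : V} (hu : u ∈ S)
    (hv : v ∈ out G S r u) :
    p ^ 2 - 2 * m * p ^ 4 - 2 * p ^ 3 * dg G (out G S r u) v ≤
      ∑ R, w R * (if u ∈ RR G S r R ∧ v ∈ RR G S r R then 1 else 0) := by
  have hv' := mem_filter.1 hv
  have hlt := hv'.2.2
  have huv := hv'.2.1.ne
  have hu1 : u ∉ out G S r u := fun h => lt_irrefl _ (mem_filter.1 h).2.2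
  have hu2 : u ∉ out G S r v := fun h => by have := (mem_filter.1 h).2.2; omega
  have hv2 : v ∉ out G S r v := fun h => lt_irrefl _ (mem_filter.1 h).2.2
  have h1 := QQ_exp (G := G) w p hp0 hT (out G S r u) u v huv hu1
  have h2 := QQ_exp (G := G) w p hp0 hT (out G S r v) u v huv hu2
  rw [if_pos hv] at h1
  rw [if_neg hv2] at h2
  have h3 : ∑ R, w R * (ind {u, v} R - QQ G (out G S r u) u v R - QQ G (out G S r v) u v R) ≤
      ∑ R, w R * (if u ∈ RR G S r R ∧ v ∈ RR G S r R then 1 else 0) :=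
    sum_le_sum fun R _ => mul_le_mul_of_nonneg_left (edge_pointwise hu hv'.1 R) (hw R)
  simp_rw [mul_sub] at h3
  rw [sum_sub_distrib, sum_sub_distrib, hT, card_pair huv] at h3
  have p4 : 0 ≤ p ^ 4 := by positivity
  have h4 := mul_le_mul_of_nonneg_left (hm u hu) p4
  have h5 := mul_le_mul_of_nonneg_left (hm v hv'.1) p4
  linarith

lemma edges_le {G : SimpleGraph V} {S : Finset V} {r : V → ℕ} (R : Finset V) :
    ∑ u ∈ S, ∑ v ∈ out G S r u, (if u ∈ RR G S r R ∧ v ∈ RR G S r R then (1 : ℝ) else 0) ≤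
      ∑ u ∈ RR G S r R, ((out G (RR G S r R) r u).card : ℝ) := by
  have hsub : RR G S r R ⊆ S := fun u hu => (mem_RR.1 hu).1.1
  rw [← sum_subset hsub (f := fun u => ∑ v ∈ out G S r u,
    (if u ∈ RR G S r R ∧ v ∈ RR G S r R then (1 : ℝ) else 0))]
  · refine sum_le_sum fun u hu => ?_
    rw [← sum_filter, sum_const, nsmul_eq_mul, mul_one]
    have : #({v ∈ out G S r u | u ∈ RR G S r R ∧ v ∈ RR G S r R}) ≤
        (out G (RR G S r R) r u).card := by
      refine card_le_card fun v hv => ?_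
      rw [mem_filter] at hv
      exact mem_filter.2 ⟨hv.2.2, (mem_filter.1 hv.1).2⟩
    exact_mod_cast this
  · intro u _ hu
    exact sum_eq_zero fun v _ => if_neg fun h => hu h.1

lemma step1_core [Fintype V] {G : SimpleGraph V} {S : Finset V} {r : V → ℕ} {d D : ℕ} (m : ℝ)
    (hD : 1 ≤ D) (hdD : 8 * D ≤ d) (hne : S.Nonempty) (hmin : ∀ v ∈ S, d ≤ dg G S v)
    (hr : Set.InjOn r S) (hm0 : 0 ≤ m)
    (hm : ∀ u ∈ S, (vol G (out G S r u) : ℝ) ≤ m) (hmd : 512 * D ^ 2 * m ≤ d ^ 2) :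
    ∃ T : Finset V, TriFree G T ∧ 2 * (D * T.card) < vol G T := by
  have hDR : (1 : ℝ) ≤ D := by exact_mod_cast hD
  have hdR : 8 * (D : ℝ) ≤ d := by exact_mod_cast hdD
  have hd0 : (0 : ℝ) < d := by linarith
  set p : ℝ := 8 * D / d with hp
  have hp0 : 0 < p := by positivity
  have hp1 : p ≤ 1 := by rw [hp, div_le_one hd0]; exact hdR
  have hpd : p * d = 8 * D := by rw [hp]; field_simp
  have hmp : m * p ^ 2 ≤ 1 / 8 := by
    rw [hp, div_pow, mul_div_assoc', div_le_iff₀ (by positivity)]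
    nlinarith
  obtain ⟨w, hw, hT'⟩ := sampling V p hp0.le hp1
  have hT : ∀ T : Finset V, ∑ R, w R * ind T R = p ^ T.card := hT'
  set F : Finset V → ℝ := fun R => ∑ u ∈ S, ∑ v ∈ out G S r u,
    (if u ∈ RR G S r R ∧ v ∈ RR G S r R then (1 : ℝ) else 0) with hF
  set E : ℝ := ∑ u ∈ S, ((out G S r u).card : ℝ) with hE
  have hE1 : (S.card : ℝ) * d ≤ 2 * E := by
    have h1 := vol_eq (G := G) hr
    have h2 : S.card * d ≤ vol G S := by
      rw [← smul_eq_mul]; exact card_nsmul_le_sum _ _ _ hmin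
    rw [h1] at h2
    rw [hE]
    exact_mod_cast h2
  have hEF : E * (p ^ 2 - 2 * m * p ^ 4) - S.card * (2 * p ^ 3 * m) ≤ ∑ R, w R * F R := by
    calc E * (p ^ 2 - 2 * m * p ^ 4) - S.card * (2 * p ^ 3 * m)
        = ∑ u ∈ S, (((out G S r u).card : ℝ) * (p ^ 2 - 2 * m * p ^ 4) - 2 * p ^ 3 * m) := by
          rw [sum_sub_distrib, hE, sum_mul, sum_const, nsmul_eq_mul]
      _ ≤ ∑ u ∈ S, ∑ v ∈ out G S r u,
          (p ^ 2 - 2 * m * p ^ 4 - 2 * p ^ 3 * dg G (out G S r u) v) := by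
          refine sum_le_sum fun u hu => ?_
          rw [sum_sub_distrib, sum_const, nsmul_eq_mul, ← mul_sum]
          have h1 : (∑ v ∈ out G S r u, (dg G (out G S r u) v : ℝ)) ≤ m := by
            have := hm u hu
            unfold vol at this
            exact_mod_cast this
          have h2 := mul_le_mul_of_nonneg_left h1 (show 0 ≤ 2 * p ^ 3 by positivity)
          linarith
      _ ≤ ∑ u ∈ S, ∑ v ∈ out G S r u,
          ∑ R, w R * (if u ∈ RR G S r R ∧ v ∈ RR G S r R then 1 else 0) :=
          sum_le_sum fun u hu => sum_le_sum fun v hv => edge_exp w p m hw hp0.le hT hm hu hv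
      _ = ∑ R, w R * F R := by
          simp_rw [hF, mul_sum]
          conv_rhs => rw [sum_comm]
          refine sum_congr rfl fun u _ => ?_
          rw [sum_comm]
  have hn : (0 : ℝ) < S.card := by exact_mod_cast hne.card_pos
  obtain ⟨R, hR⟩ := exists_pos_of_exp w (fun R => F R - D * ((S ∩ R).card : ℝ)) hw (by
    have h1 : ∑ R, w R * (F R - D * ((S ∩ R).card : ℝ)) =
        ∑ R, w R * F R - D * (p * S.card) := by
      rw [← exp_card w p hT S, mul_sum, ← sum_sub_distrib]
      exact sum_congr rfl fun R _ => by ring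
    rw [h1]
    have e0 : 0 ≤ E := sum_nonneg fun u _ => by positivity
    have e1 : E * (p ^ 2 * (3 / 4)) ≤ E * (p ^ 2 - 2 * m * p ^ 4) := by
      refine mul_le_mul_of_nonneg_left ?_ e0
      nlinarith [mul_le_mul_of_nonneg_right hmp (sq_nonneg p)]
    have e2 : (S.card : ℝ) * (2 * p ^ 3 * m) ≤ S.card * (p / 4) := by
      refine mul_le_mul_of_nonneg_left ?_ hn.le
      nlinarith [mul_le_mul_of_nonneg_right hmp hp0.le]
    have e3 : (S.card : ℝ) * p * (3 * D) ≤ E * (p ^ 2 * (3 / 4)) := by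
      have : (S.card : ℝ) * p * (3 * D) = (S.card * d) * (p ^ 2 * (3 / 8)) := by
        have : (S.card : ℝ) * d * (p ^ 2 * (3 / 8)) = S.card * p * (3 / 8) * (p * d) := by ring
        rw [this, hpd]; ring
      rw [this]
      have := mul_le_mul_of_nonneg_right hE1 (show 0 ≤ p ^ 2 * (3 / 8) by positivity)
      linarith
    have e4 : 0 < (S.card : ℝ) * p := by positivity
    nlinarith)
  refine ⟨RR G S r R, RR_triFree hr R, ?_⟩
  have hsub : RR G S r R ⊆ S := fun u hu => (mem_RR.1 hu).1.1
  rw [vol_eq (hr.mono hsub)]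
  have h1 := edges_le (G := G) (S := S) (r := r) R
  have h2 : (RR G S r R).card ≤ (S ∩ R).card := card_le_card (filter_subset _ _)
  have h2' : (D : ℝ) * (RR G S r R).card ≤ D * (S ∩ R).card := by gcongr
  have h3 : (D : ℝ) * (RR G S r R).card < ∑ u ∈ RR G S r R, ((out G (RR G S r R) r u).card : ℝ) := by
    have hR' : 0 < F R - D * ((S ∩ R).card : ℝ) := hR
    have : F R ≤ _ := h1
    linarith
  have h4 : D * (RR G S r R).card < ∑ u ∈ RR G S r R, (out G (RR G S r R) r u).card := by
    exact_mod_cast h3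
  omega


lemma step1 : ∃ q : Polynomial ℕ, ∀ (V : Type) [Fintype V] (G : SimpleGraph V),
    ¬ Paper.ContainsTheta G → ∀ w : ℕ, (∀ K : Finset V, G.IsClique K → K.card ≤ w) →
    vol G univ ≤ q.eval w * Fintype.card V := by
  obtain ⟨D, hD, hstep⟩ := step2
  refine ⟨Polynomial.C 2 * (Polynomial.C (512 ^ 2 * D ^ 4) *
    (Polynomial.X * (Polynomial.X ^ 2 + Polynomial.X + 1)) + Polynomial.C (8 * D)),
    fun V _ G hG w hw => ?_⟩
  have heval : Polynomial.eval w (Polynomial.C 2 * (Polynomial.C (512 ^ 2 * D ^ 4) *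
    (Polynomial.X * (Polynomial.X ^ 2 + Polynomial.X + 1)) + Polynomial.C (8 * D))) =
      2 * (512 ^ 2 * D ^ 4 * (w * (w ^ 2 + w + 1)) + 8 * D) := by
    simp only [Polynomial.eval_mul, Polynomial.eval_add, Polynomial.eval_C, Polynomial.eval_X,
      Polynomial.eval_pow, Polynomial.eval_one]
  rw [heval, mul_assoc]
  apply vol_le
  by_contra hnd
  obtain ⟨S, -, hne, d, hd, hmin, hdeg⟩ := exists_dense hnd
  obtain ⟨r, hr, ho⟩ := exists_rank G d S hdeg
  have hDR : (1 : ℝ) ≤ D := by exact_mod_cast hD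
  obtain ⟨T, hT, hTv⟩ := step1_core (G := G) (S := S) (r := r) (d := d) (D := D)
    ((d : ℝ) ^ 2 / (512 * D ^ 2)) hD (by omega) hne hmin hr (by positivity)
    (by
      intro u hu
      have h1 := sparse hG hw (out G S r u)
      have h2 : (vol G (out G S r u)) ^ 2 ≤ d ^ 3 * (w * (w ^ 2 + w + 1)) :=
        h1.trans (Nat.mul_le_mul_right _ (Nat.pow_le_pow_left (ho u hu) 3))
      have h3 : (512 * D ^ 2 * vol G (out G S r u)) ^ 2 ≤ (d ^ 2) ^ 2 := by
        calc (512 * D ^ 2 * vol G (out G S r u)) ^ 2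
            = 512 ^ 2 * D ^ 4 * (vol G (out G S r u)) ^ 2 := by ring
          _ ≤ 512 ^ 2 * D ^ 4 * (d ^ 3 * (w * (w ^ 2 + w + 1))) := Nat.mul_le_mul_left _ h2
          _ = d ^ 3 * (512 ^ 2 * D ^ 4 * (w * (w ^ 2 + w + 1))) := by ring
          _ ≤ d ^ 3 * d := Nat.mul_le_mul_left _ (by omega)
          _ = _ := by ring
      have h4 : 512 * D ^ 2 * vol G (out G S r u) ≤ d ^ 2 :=
        (Nat.pow_le_pow_iff_left (by norm_num)).1 h3
      rw [le_div_iff₀ (by positivity)]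
      have h5 : (512 : ℝ) * D ^ 2 * vol G (out G S r u) ≤ d ^ 2 := by exact_mod_cast h4
      linarith)
    (by
      refine le_of_eq ?_
      field_simp)
  have := hstep V G hG T hT
  omega

end ThetaProof

/-- Theta-free graphs have average degree at most a polynomial in the clique number:
`2|E(G)| ≤ q(ω(G)) · |V(G)|`. -/
theorem thetaFree_average_degree :
    ∃ q : Polynomial ℕ, ∀ (V : Type) [Fintype V] [DecidableEq V] (G : SimpleGraph V)
      [DecidableRel G.Adj],
      Paper.ThetaFree G →
      2 * (G.edgeFinset.card : ℝ) ≤ ((q.eval G.cliqueNum : ℕ) : ℝ) * (Fintype.card V : ℝ) := by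
  obtain ⟨q, hq⟩ := ThetaProof.step1
  refine ⟨q, fun V _ _ G _ hG => ?_⟩
  have h := hq V G hG G.cliqueNum (fun K hK => hK.card_le_cliqueNum)
  have h1 : ThetaProof.vol G Finset.univ = 2 * G.edgeFinset.card := by
    rw [← G.sum_degrees_eq_twice_card_edges]
    unfold ThetaProof.vol ThetaProof.dg
    refine Finset.sum_congr rfl fun v _ => ?_
    rw [← SimpleGraph.card_neighborFinset_eq_degree]
    congr 1
    ext u
    simp
  rw [h1] at h
  exact_mod_cast h
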